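/- arXiv:0709.1297 — 2 statements merged into one kernel-verified Lean document; each statement's English description precedes it below -/
import Mathlib

section
/- Let K be any field and H, G finite groups with neither trivial. Then there exist K-embeddings α : K(H) → K(H × G) and β : K(G) → K(H × G) whose images generate a free composite (i.e. the compositum F = α(K(H)) · β(K(G)) inside K(H × G) has transcendence degree over K equal to |H| + |G|, the sum of the transcendence degrees of K(H) and K(G)), and K(H × G) is rational (purely transcendental) over this compositum F. -/
set_option synthInstance.maxHeartbeats 1000000
set_option maxHeartbeats 1000000

noncomputable section

/-- The rational function field `K(x(g) : g ∈ G)` in variables indexed by `G`. -/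
abbrev NoetherBigField (K : Type*) [Field K] (G : Type*) : Type _ :=
  FractionRing (MvPolynomial G K)

/-- The `K`-automorphism of `K(x(g) : g ∈ G)` induced by `h · x(g) = x(hg)`. -/
def noetherAut (K : Type*) [Field K] (G : Type*) [Group G] (h : G) :
    NoetherBigField K G ≃ₐ[K] NoetherBigField K G :=
  IsFractionRing.algEquivOfAlgEquiv (MvPolynomial.renameEquiv K (Equiv.mulLeft h))

/-- The fixed field `K(G) = K(x(g) : g ∈ G)^G`, as a subfield. -/
def noetherSubfield (K : Type*) [Field K] (G : Type*) [Group G] :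
    Subfield (NoetherBigField K G) where
  carrier := {x | ∀ h : G, noetherAut K G h x = x}
  mul_mem' := by intro a b ha hb h; rw [map_mul, ha h, hb h]
  one_mem' := by intro h; rw [map_one]
  add_mem' := by intro a b ha hb h; rw [map_add, ha h, hb h]
  zero_mem' := by intro h; rw [map_zero]
  neg_mem' := by intro a ha h; rw [map_neg, ha h]
  inv_mem' := by intro a ha h; rw [map_inv₀, ha h]

/-- Noether's fixed field `K(G) = K(x(g) : g ∈ G)^G`. -/
def NoetherField (K : Type*) [Field K] (G : Type*) [Group G] : Type _ :=
  noetherSubfield K G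

instance (K : Type*) [Field K] (G : Type*) [Group G] : Field (NoetherField K G) :=
  inferInstanceAs (Field (noetherSubfield K G))

theorem algebraMap_mem_noetherSubfield (K : Type*) [Field K] (G : Type*) [Group G] (c : K) :
    algebraMap K (NoetherBigField K G) c ∈ noetherSubfield K G := by
  intro h
  exact AlgEquiv.commutes _ c

instance (K : Type*) [Field K] (G : Type*) [Group G] : Algebra K (NoetherField K G) :=
  RingHom.toAlgebra <|
    ((algebraMap K (NoetherBigField K G)).codRestrict (noetherSubfield K G).toSubring
      (algebraMap_mem_noetherSubfield K G))

/-- An extension `L/F` is rational (purely transcendental) if `L` is `F`-isomorphic to a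
rational function field `F(t₁, …, tₙ)` over `F` in finitely many variables. -/
def IsRationalExtension (F L : Type*) [Field F] [Field L] [Algebra F L] : Prop :=
  ∃ n : ℕ, Nonempty (L ≃ₐ[F] FractionRing (MvPolynomial (Fin n) F))

/-- An extension `L/F` is stably rational if the rational function field `L(y₁, …, y_r)`
is rational over `F` for some finite number `r` of indeterminates. -/
def IsStablyRationalExtension (F L : Type*) [Field F] [Field L] [Algebra F L] : Prop :=
  ∃ r : ℕ, IsRationalExtension F (FractionRing (MvPolynomial (Fin r) L))


theorem nbf_ext {K : Type*} [Field K] {I L : Type*} [Field L] [Algebra K L]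
    {f g : NoetherBigField K I →ₐ[K] L}
    (h : ∀ i, f (algebraMap (MvPolynomial I K) _ (MvPolynomial.X i)) =
      g (algebraMap (MvPolynomial I K) _ (MvPolynomial.X i))) : f = g := by
  have h1 : f.comp (IsScalarTower.toAlgHom K (MvPolynomial I K) (NoetherBigField K I)) =
      g.comp (IsScalarTower.toAlgHom K (MvPolynomial I K) (NoetherBigField K I)) := by
    apply MvPolynomial.algHom_ext
    intro i
    simpa using h i
  apply AlgHom.ext
  intro x
  obtain ⟨a, b, hb, rfl⟩ := IsFractionRing.div_surjective (A := MvPolynomial I K) x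
  have ha' := DFunLike.congr_fun h1 a
  have hb' := DFunLike.congr_fun h1 b
  simp only [AlgHom.comp_apply, IsScalarTower.toAlgHom_apply] at ha' hb'
  rw [map_div₀, map_div₀, ha', hb']

/-- The variable `x(g)`. -/
def nvar (K : Type*) [Field K] (I : Type*) (i : I) : NoetherBigField K I :=
  algebraMap (MvPolynomial I K) _ (MvPolynomial.X i)

theorem noetherAut_nvar (K : Type*) [Field K] (G : Type*) [Group G] (h g : G) :
    noetherAut K G h (nvar K G g) = nvar K G (h * g) := by
  simp [noetherAut, nvar]

theorem noetherAut_mul (K : Type*) [Field K] (G : Type*) [Group G] (h g : G)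
    (x : NoetherBigField K G) :
    noetherAut K G (h * g) x = noetherAut K G h (noetherAut K G g x) := by
  have : (noetherAut K G (h * g) : NoetherBigField K G →ₐ[K] NoetherBigField K G) =
      (noetherAut K G h : NoetherBigField K G →ₐ[K] NoetherBigField K G).comp
      (noetherAut K G g : NoetherBigField K G →ₐ[K] NoetherBigField K G) := by
    apply nbf_ext
    intro i
    have := noetherAut_nvar K G
    unfold nvar at this
    simp [this, mul_assoc]
  exact DFunLike.congr_fun this x

theorem noetherAut_one (K : Type*) [Field K] (G : Type*) [Group G]
    (x : NoetherBigField K G) :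
    noetherAut K G 1 x = x := by
  have : (noetherAut K G 1 : NoetherBigField K G →ₐ[K] NoetherBigField K G) =
      AlgHom.id K _ := by
    apply nbf_ext
    intro i
    have := noetherAut_nvar K G
    unfold nvar at this
    simp [this]
  exact DFunLike.congr_fun this x

theorem nvar_adjoin (K : Type*) [Field K] (I : Type*) :
    IntermediateField.adjoin K (Set.range (nvar K I)) = ⊤ := by
  rw [eq_top_iff]
  intro x _
  have key : ∀ a : MvPolynomial I K, algebraMap (MvPolynomial I K) (NoetherBigField K I) a ∈
      IntermediateField.adjoin K (Set.range (nvar K I)) := by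
    intro a
    induction a using MvPolynomial.induction_on with
    | C c =>
      have : algebraMap (MvPolynomial I K) (NoetherBigField K I) (MvPolynomial.C c) =
        algebraMap K _ c := by
        rw [← MvPolynomial.algebraMap_eq, ← IsScalarTower.algebraMap_apply]
      rw [this]
      exact IntermediateField.algebraMap_mem _ _
    | add p q hp hq => rw [map_add]; exact add_mem hp hq
    | mul_X p i hp =>
      rw [map_mul]
      exact mul_mem hp (IntermediateField.subset_adjoin _ _ ⟨i, rfl⟩)
  obtain ⟨a, b, hb, rfl⟩ := IsFractionRing.div_surjective (A := MvPolynomial I K) x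
  exact div_mem (key a) (key b)

theorem trdeg_nbf (K : Type*) [Field K] (I : Type*) [Finite I] :
    Algebra.trdeg K (NoetherBigField K I) = (Nat.card I : Cardinal) := by
  have : Algebra.IsAlgebraic (MvPolynomial I K) (NoetherBigField K I) :=
    IsLocalization.isAlgebraic _ (nonZeroDivisors (MvPolynomial I K))
  have h := (IsTranscendenceBasis.mvPolynomial I K)
  have h2 := h.algebraMap_comp (A := NoetherBigField K I)
  have h3 := h2.lift_cardinalMk_eq_trdeg
  have := Fintype.ofFinite I
  rw [Cardinal.mk_fintype, Cardinal.lift_natCast] at h3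
  rw [← Cardinal.lift_inj, ← h3, Nat.card_eq_fintype_card, Cardinal.lift_natCast]

theorem isAlgebraic_of_adjoin_eq_top {F E : Type*} [Field F] [Field E] [Algebra F E]
    {S : Set E} (h : IntermediateField.adjoin F S = ⊤) :
    Algebra.IsAlgebraic (Algebra.adjoin F S) E := by
  constructor
  intro x
  have hx : x ∈ IntermediateField.adjoin F S := by rw [h]; trivial
  obtain ⟨r, hr, s, hs, rfl⟩ := IntermediateField.mem_adjoin_iff_div.1 hx
  have h1 : IsAlgebraic (Algebra.adjoin F S) r := isAlgebraic_algebraMap (⟨r, hr⟩ : Algebra.adjoin F S)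
  have h2 : IsAlgebraic (Algebra.adjoin F S) s := isAlgebraic_algebraMap (⟨s, hs⟩ : Algebra.adjoin F S)
  rw [div_eq_mul_inv]
  exact h1.mul h2.inv

/-- evaluation test: a sum of variables -/
theorem sum_nvar_inj (K : Type*) [Field K] (I : Type*) (s t : Finset I)
    (h : ∑ i ∈ s, nvar K I i = ∑ i ∈ t, nvar K I i) : s = t := by
  classical
  unfold nvar at h
  rw [← map_sum, ← map_sum] at h
  have h1 := IsFractionRing.injective (MvPolynomial I K) (NoetherBigField K I) h
  ext i
  have h2 := congrArg (MvPolynomial.eval (Pi.single i (1 : K))) h1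
  simp only [map_sum, MvPolynomial.eval_X] at h2
  by_cases h3 : i ∈ s <;> by_cases h4 : i ∈ t <;> simp_all


/-- Dedekind plus duality. -/
theorem span_orbit_eq_top {K L Γ : Type*} [Field K] [Field L] [Algebra K L] [Fintype Γ]
    (M : IntermediateField K L) (σ : Γ → (M →ₐ[K] M)) (hσ : Function.Injective σ) :
    Submodule.span M (Set.range (fun c : M => (fun γ => σ γ c : Γ → M))) = ⊤ := by
  classical
  by_contra hne
  obtain ⟨f, hf0, hf⟩ := Submodule.exists_le_ker_of_lt_top _ (lt_top_iff_ne_top.2 hne)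
  apply hf0
  have hli := linearIndependent_monoidHom M M
  have hinj : Function.Injective (fun γ => ((σ γ : M →* M))) := by
    intro γ δ h
    apply hσ
    ext c
    exact congrArg _ (DFunLike.congr_fun h c)
  have hli2 := hli.comp _ hinj
  rw [Fintype.linearIndependent_iff] at hli2
  have h0 := hli2 (fun γ => f (Pi.single γ 1)) (by
    ext c
    have h1 : f (fun γ => σ γ c) = 0 := hf (Submodule.subset_span ⟨c, rfl⟩)
    rw [LinearMap.pi_apply_eq_sum_univ] at h1
    simp only [Finset.sum_apply, Pi.smul_apply, Function.comp, smul_eq_mul, Pi.zero_apply]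
    have h2 : ∀ γ, f (Pi.single γ 1) = f (fun j => if γ = j then 1 else 0) := by
      intro γ; congr 1; ext j; simp [Pi.single_apply, eq_comm]
    rw [← h1]
    congr 1
    refine Finset.sum_congr rfl fun γ _ => ?_
    rw [h2, mul_comm]
    rfl)
  apply LinearMap.pi_ext'
  intro γ
  ext
  simpa using h0 γ

theorem main_one (K : Type*) [Field K] (H G : Type*) [Group H] [Group G] [Finite H] [Finite G]
    [Nontrivial H] [Nontrivial G] :
    ∃ (a : H → NoetherBigField K (H × G)) (b : G → NoetherBigField K (H × G)) (k : ℕ)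
      (t : Fin k → NoetherBigField K (H × G)),
      (∀ h g h', noetherAut K (H × G) (h, g) (a h') = a (h * h')) ∧
      (∀ h g g', noetherAut K (H × G) (h, g) (b g') = b (g * g')) ∧
      (∀ γ i, noetherAut K (H × G) γ (t i) = t i) ∧
      Nat.card H + Nat.card G + k ≤ Nat.card (H × G) ∧
      IntermediateField.adjoin K (Set.range a ∪ Set.range b ∪ Set.range t) = ⊤ := by
  classical
  have := Fintype.ofFinite H
  have := Fintype.ofFinite G
  let x := nvar K (H × G)
  let a : H → NoetherBigField K (H × G) := fun h => ∑ g, x (h, g)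
  let b : G → NoetherBigField K (H × G) := fun g => ∑ h, x (h, g)
  have ha : ∀ h g h', noetherAut K (H × G) (h, g) (a h') = a (h * h') := by
    intro h g h'
    simp only [a, map_sum, x, noetherAut_nvar, Prod.mk_mul_mk]
    exact Fintype.sum_equiv (Equiv.mulLeft g) _ _ (fun _ => rfl)
  have hb : ∀ h g g', noetherAut K (H × G) (h, g) (b g') = b (g * g') := by
    intro h g h'
    simp only [b, map_sum, x, noetherAut_nvar, Prod.mk_mul_mk]
    exact Fintype.sum_equiv (Equiv.mulLeft h) _ _ (fun _ => rfl)
  have hab : ∑ h, a h = ∑ g, b g := Finset.sum_comm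
  have hs0 : ∑ g, b g ≠ 0 := by
    rw [← hab]
    intro h0
    have h1 : ∑ γ ∈ (Finset.univ : Finset (H × G)), nvar K (H × G) γ = ∑ γ ∈ ∅, nvar K (H × G) γ := by
      rw [Finset.sum_empty, ← h0, Fintype.sum_prod_type]
    have := sum_nvar_inj _ _ _ _ h1
    exact Finset.univ_nonempty.ne_empty this
  have hainj : Function.Injective a := by
    intro h h' e
    have e' : ∑ γ ∈ Finset.univ.map (Function.Embedding.sectR h G), nvar K (H × G) γ =
      ∑ γ ∈ Finset.univ.map (Function.Embedding.sectR h' G), nvar K (H × G) γ := by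
      simpa [a, x] using e
    have := sum_nvar_inj _ _ _ _ e'
    have h2 : (h, (1 : G)) ∈ Finset.univ.map (Function.Embedding.sectR h' G) := by
      rw [← this]; simp
    simpa [eq_comm] using h2
  have hbinj : Function.Injective b := by
    intro h h' e
    have e' : ∑ γ ∈ Finset.univ.map (Function.Embedding.sectL H h), nvar K (H × G) γ =
      ∑ γ ∈ Finset.univ.map (Function.Embedding.sectL H h'), nvar K (H × G) γ := by
      simpa [b, x] using e
    have := sum_nvar_inj _ _ _ _ e'
    have h2 : ((1 : H), h) ∈ Finset.univ.map (Function.Embedding.sectL H h') := by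
      rw [← this]; simp
    simpa [eq_comm] using h2
  let M : IntermediateField K (NoetherBigField K (H × G)) :=
    IntermediateField.adjoin K (Set.range a ∪ Set.range b)
  have haM : ∀ h, a h ∈ M := fun h => IntermediateField.subset_adjoin _ _ (Or.inl ⟨h, rfl⟩)
  have hbM : ∀ h, b h ∈ M := fun h => IntermediateField.subset_adjoin _ _ (Or.inr ⟨h, rfl⟩)
  have hM : ∀ γ : H × G, ∀ m ∈ M, noetherAut K (H × G) γ m ∈ M := by
    rintro ⟨h, g⟩
    have : M ≤ M.comap (noetherAut K (H × G) (h, g) :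
        NoetherBigField K (H × G) →ₐ[K] NoetherBigField K (H × G)) := by
      apply IntermediateField.adjoin_le_iff.2
      rintro _ (⟨h', rfl⟩ | ⟨g', rfl⟩)
      · show noetherAut K (H × G) (h, g) (a h') ∈ M
        rw [ha]; exact haM _
      · show noetherAut K (H × G) (h, g) (b g') ∈ M
        rw [hb]; exact hbM _
    exact fun m hm => this hm
  let σ : H × G → (M →ₐ[K] M) := fun γ =>
    ((noetherAut K (H × G) γ :
        NoetherBigField K (H × G) →ₐ[K] NoetherBigField K (H × G)).comp M.val).codRestrict
      M.toSubalgebra (fun m => hM γ m m.2)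
  have hσval : ∀ γ m, (σ γ m : NoetherBigField K (H × G)) = noetherAut K (H × G) γ m :=
    fun _ _ => rfl
  have hσ : Function.Injective σ := by
    rintro ⟨h, g⟩ ⟨h', g'⟩ e
    have e1 := congrArg Subtype.val (DFunLike.congr_fun e ⟨a 1, haM 1⟩)
    have e2 := congrArg Subtype.val (DFunLike.congr_fun e ⟨b 1, hbM 1⟩)
    rw [hσval, hσval] at e1 e2
    simp only [ha, hb, mul_one] at e1 e2
    rw [hainj e1, hbinj e2]
  have hspan := span_orbit_eq_top M σ hσ
  let Φ : (H × G → M) →ₗ[M] NoetherBigField K (H × G) := Fintype.linearCombination M x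
  let T : M → NoetherBigField K (H × G) := fun c => Φ (fun γ => σ γ c)
  have hTdef : ∀ c, T c = ∑ γ, noetherAut K (H × G) γ c * x γ := fun c => by
    simp only [T, Φ, Fintype.linearCombination_apply]
    rfl
  have hTinv : ∀ γ c, noetherAut K (H × G) γ (T c) = T c := by
    intro γ c
    simp only [hTdef, map_sum, map_mul, ← noetherAut_mul, x, noetherAut_nvar]
    exact Fintype.sum_equiv (Equiv.mulLeft γ) _ _ (fun _ => rfl)
  have hxT : ∀ γ, x γ ∈ Submodule.span M (Set.range T) := by
    intro γ
    have h1 : Submodule.map Φ ⊤ = Submodule.span M (Set.range T) := by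
      rw [← hspan, Submodule.map_span, ← Set.range_comp]
      rfl
    rw [← h1]
    refine ⟨Pi.single γ 1, trivial, ?_⟩
    simp [Φ, Fintype.linearCombination_apply_single]
  obtain ⟨s, hsT, h1s, hspans, hlis⟩ := exists_linearIndepOn_id_extension
    (K := M) (s := {1}) (t := insert 1 (Set.range T))
    (LinearIndepOn.singleton (v := id) (R := M) (one_ne_zero : (1 : NoetherBigField K (H × G)) ≠ 0)) (by simp)
  -- small spanning set
  let w : Finset (NoetherBigField K (H × G)) := insert 1
    (((Finset.univ.erase (1 : H)) ×ˢ (Finset.univ.erase (1 : G))).image x)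
  have hwcard : w.card ≤ (Nat.card H - 1) * (Nat.card G - 1) + 1 := by
    refine (Finset.card_insert_le _ _).trans ?_
    gcongr
    refine Finset.card_image_le.trans ?_
    simp [Nat.card_eq_fintype_card]
  have hM1 : ∀ m ∈ M, m ∈ Submodule.span M (w : Set (NoetherBigField K (H × G))) := by
    intro m hm
    have : m = (⟨m, hm⟩ : M) • (1 : NoetherBigField K (H × G)) := by
      rw [IntermediateField.smul_def]; simp
    rw [this]
    exact Submodule.smul_mem _ _ (Submodule.subset_span (by simp [w]))
  have hxw1 : ∀ h g, h ≠ 1 → g ≠ 1 → x (h, g) ∈ Submodule.span M (w : Set (NoetherBigField K (H × G))) := by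
    intro h g hh hg
    apply Submodule.subset_span
    simp only [w, Finset.coe_insert, Finset.coe_image]
    refine Or.inr ⟨(h, g), ?_, rfl⟩
    simp [hh, hg]
  have hxw2 : ∀ h g, h ≠ 1 → x (h, g) ∈ Submodule.span M (w : Set (NoetherBigField K (H × G))) := by
    intro h g hh
    by_cases hg : g = 1
    · subst hg
      have : x (h, 1) = a h - ∑ g ∈ Finset.univ.erase 1, x (h, g) := by
        rw [eq_sub_iff_add_eq, Finset.add_sum_erase _ (fun g => x (h, g)) (Finset.mem_univ _)]
      rw [this]
      refine sub_mem (hM1 _ (haM _)) (sum_mem fun g hg => hxw1 _ _ hh (Finset.ne_of_mem_erase hg))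
    · exact hxw1 _ _ hh hg
  have hxw : ∀ γ, x γ ∈ Submodule.span M (w : Set (NoetherBigField K (H × G))) := by
    rintro ⟨h, g⟩
    by_cases hh : h = 1
    · subst hh
      have : x (1, g) = b g - ∑ h ∈ Finset.univ.erase 1, x (h, g) := by
        rw [eq_sub_iff_add_eq, Finset.add_sum_erase _ (fun h => x (h, g)) (Finset.mem_univ _)]
      rw [this]
      refine sub_mem (hM1 _ (hbM _)) (sum_mem fun h hh => hxw2 _ _ (Finset.ne_of_mem_erase hh))
    · exact hxw2 _ _ hh
  have hTw : ∀ c, T c ∈ Submodule.span M (w : Set (NoetherBigField K (H × G))) := by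
    intro c
    simp only [T, Φ, Fintype.linearCombination_apply]
    exact sum_mem fun γ _ => Submodule.smul_mem _ _ (hxw γ)
  have hsw : Set.range ((↑) : s → NoetherBigField K (H × G)) ≤
      Submodule.span M (w : Set (NoetherBigField K (H × G))) := by
    rintro _ ⟨⟨y, hy⟩, rfl⟩
    rcases hsT hy with rfl | ⟨c, rfl⟩
    · exact hM1 _ (one_mem _)
    · exact hTw c
  have hli' : LinearIndependent M ((↑) : s → NoetherBigField K (H × G)) := hlis
  have hcard := linearIndependent_le_span' _ hli' _ hsw
  have hsfin : s.Finite := by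
    rw [← Cardinal.lt_aleph0_iff_set_finite]
    exact hcard.trans_lt (Cardinal.natCast_lt_aleph0)
  have := hsfin.fintype
  have hscard : s.toFinset.card ≤ (Nat.card H - 1) * (Nat.card G - 1) + 1 := by
    rw [Cardinal.mk_fintype, Nat.cast_le] at hcard
    rw [Set.toFinset_card]
    refine hcard.trans ?_
    simpa using hwcard
  let S := s.toFinset.erase 1
  have hScard : S.card ≤ (Nat.card H - 1) * (Nat.card G - 1) := by
    have : S.card = s.toFinset.card - 1 := Finset.card_erase_of_mem (by simpa using h1s)
    omega
  have hSinv : ∀ γ, ∀ y ∈ S, noetherAut K (H × G) γ y = y := by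
    intro γ y hy
    have hy' : y ≠ 1 ∧ y ∈ s := by simpa [S] using hy
    rcases hsT hy'.2 with h | ⟨c, rfl⟩
    · exact absurd h hy'.1
    · exact hTinv _ _
  have hS0 : ∀ y ∈ S, y ≠ 0 := by
    intro y hy
    have hy' : y ≠ 1 ∧ y ∈ s := by simpa [S] using hy
    exact hli'.ne_zero ⟨y, hy'.2⟩
  have hgen : ∀ N : IntermediateField K (NoetherBigField K (H × G)),
      (∀ h, a h ∈ N) → (∀ g, b g ∈ N) → (∀ y ∈ S, y ∈ N) → N = ⊤ := by
    intro N h1 h2 h3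
    have hMN : M ≤ N := by
      apply IntermediateField.adjoin_le_iff.2
      rintro _ (⟨h', rfl⟩ | ⟨g', rfl⟩)
      · exact h1 _
      · exact h2 _
    rw [eq_top_iff, ← nvar_adjoin, IntermediateField.adjoin_le_iff]
    rintro _ ⟨γ, rfl⟩
    have h4 : x γ ∈ Submodule.span M s := by
      have : Submodule.span M (Set.range T) ≤ Submodule.span M s :=
        Submodule.span_le.2 ((Set.subset_insert _ _).trans hspans)
      exact this (hxT γ)
    have h5 : ∀ y ∈ Submodule.span M s, y ∈ N := by
      intro y hy
      induction hy using Submodule.span_induction with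
      | mem y hy =>
        by_cases h : y = 1
        · rw [h]; exact one_mem _
        · exact h3 y (by simp [S, h, hy])
      | zero => exact zero_mem _
      | add p q _ _ hp hq => exact add_mem hp hq
      | smul m p _ hp =>
        rw [IntermediateField.smul_def, smul_eq_mul]
        exact mul_mem (hMN m.2) hp
    exact h5 _ h4
  have hH : 2 ≤ Nat.card H := Finite.one_lt_card
  have hG : 2 ≤ Nat.card G := Finite.one_lt_card
  have hcount : Nat.card H + Nat.card G + ((Nat.card H - 1) * (Nat.card G - 1) - 1) ≤
      Nat.card (H × G) := by
    rw [Nat.card_prod]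
    obtain ⟨p, hp⟩ := Nat.exists_eq_add_of_le hH
    obtain ⟨q, hq⟩ := Nat.exists_eq_add_of_le hG
    rw [hp, hq]
    have e1 : 2 + p - 1 = p + 1 := by omega
    have e2 : 2 + q - 1 = q + 1 := by omega
    rw [e1, e2]
    have : (p + 1) * (q + 1) - 1 = p * q + p + q := by
      have : (p + 1) * (q + 1) = p * q + p + q + 1 := by ring
      omega
    rw [this]
    nlinarith
  rcases S.eq_empty_or_nonempty with hSe | ⟨τ, hτ⟩
  · refine ⟨a, b, 0, Fin.elim0, ha, hb, fun _ i => i.elim0, by omega, ?_⟩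
    apply hgen
    · intro h; exact IntermediateField.subset_adjoin _ _ (Or.inl (Or.inl ⟨h, rfl⟩))
    · intro h; exact IntermediateField.subset_adjoin _ _ (Or.inl (Or.inr ⟨h, rfl⟩))
    · simp [hSe]
  · let e := (S.erase τ).equivFin
    have htmem : ∀ i, ((e.symm i : S.erase τ) : NoetherBigField K (H × G)) ∈ S := fun i =>
      Finset.mem_of_mem_erase (e.symm i).2
    refine ⟨fun h => τ * a h, b, (S.erase τ).card, fun i => (e.symm i : S.erase τ), ?_, hb, ?_, ?_, ?_⟩
    · intro h g h'
      rw [map_mul, hSinv _ _ hτ, ha]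
    · intro γ i
      exact hSinv _ _ (htmem i)
    · rw [Finset.card_erase_of_mem hτ]
      omega
    · set N := IntermediateField.adjoin K ((Set.range fun h => τ * a h) ∪ Set.range b ∪
        Set.range fun i => ((e.symm i : S.erase τ) : NoetherBigField K (H × G))) with hN
      have h1 : ∀ h, τ * a h ∈ N := fun h =>
        IntermediateField.subset_adjoin _ _ (Or.inl (Or.inl ⟨h, rfl⟩))
      have h2 : ∀ h, b h ∈ N := fun h =>
        IntermediateField.subset_adjoin _ _ (Or.inl (Or.inr ⟨h, rfl⟩))
      have h3 : τ ∈ N := by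
        have : τ = (∑ h, τ * a h) / ∑ g, b g := by
          rw [← Finset.mul_sum, hab, mul_div_cancel_right₀ _ hs0]
        rw [this]
        exact div_mem (sum_mem fun h _ => h1 h) (sum_mem fun h _ => h2 h)
      apply hgen
      · intro h
        have : a h = τ * a h / τ := by
          rw [mul_div_cancel_left₀ _ (hS0 _ hτ)]
        rw [this]
        exact div_mem (h1 h) h3
      · exact h2
      · intro y hy
        by_cases hyτ : y = τ
        · rw [hyτ]; exact h3
        · refine IntermediateField.subset_adjoin _ _ (Or.inr ⟨e ⟨y, Finset.mem_erase.2 ⟨hyτ, hy⟩⟩, ?_⟩)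
          simp


theorem nbf_isIntegral (K : Type*) [Field K] (G : Type*) [Group G] [Finite G] :
    Algebra.IsIntegral (noetherSubfield K G) (NoetherBigField K G) := by
  let act : MulSemiringAction G (NoetherBigField K G) :=
    { smul := fun g x => noetherAut K G g x
      one_smul := noetherAut_one K G
      mul_smul := noetherAut_mul K G
      smul_zero := fun g => map_zero _
      smul_add := fun g x y => map_add _ x y
      smul_one := fun g => map_one _
      smul_mul := fun g x y => map_mul _ x y }
  have : Algebra.IsInvariant (noetherSubfield K G) (NoetherBigField K G) G :=
    ⟨fun b hb => ⟨⟨b, hb⟩, rfl⟩⟩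
  exact Algebra.IsInvariant.isIntegral (noetherSubfield K G) (NoetherBigField K G) G

theorem tr_mem (K : Type*) [Field K] (G : Type*) [Group G] [Fintype G]
    (x : NoetherBigField K G) : ∑ g, noetherAut K G g x ∈ noetherSubfield K G := by
  intro h
  simp only [map_sum, ← noetherAut_mul]
  exact Fintype.sum_equiv (Equiv.mulLeft h) _ _ (fun _ => rfl)

theorem exists_tr_one (K : Type*) [Field K] (G : Type*) [Group G] [Fintype G] :
    ∃ c : NoetherBigField K G, ∑ g, noetherAut K G g c = 1 := by
  have h0 : ∑ g, nvar K G g ≠ 0 := by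
    intro h0
    have h1 : ∑ γ ∈ (Finset.univ : Finset G), nvar K G γ = ∑ γ ∈ ∅, nvar K G γ := by
      rw [Finset.sum_empty, ← h0]
    exact Finset.univ_nonempty.ne_empty (sum_nvar_inj _ _ _ _ h1)
  refine ⟨nvar K G 1 / ∑ g, nvar K G g, ?_⟩
  have h2 : ∀ h, noetherAut K G h (∑ g, nvar K G g) = ∑ g, nvar K G g := by
    intro h
    simp only [map_sum, noetherAut_nvar]
    exact Fintype.sum_equiv (Equiv.mulLeft h) _ _ (fun _ => rfl)
  simp only [map_div₀, h2, noetherAut_nvar, mul_one]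
  rw [← Finset.sum_div, div_self h0]

theorem fixed_mem (K : Type*) [Field K] (H G : Type*) [Group H] [Group G] [Finite H] [Finite G]
    (φ : NoetherBigField K H →ₐ[K] NoetherBigField K (H × G))
    (ψ : NoetherBigField K G →ₐ[K] NoetherBigField K (H × G))
    (hφ : ∀ h g u, noetherAut K (H × G) (h, g) (φ u) = φ (noetherAut K H h u))
    (hψ : ∀ h g u, noetherAut K (H × G) (h, g) (ψ u) = ψ (noetherAut K G g u))
    (N : IntermediateField K (NoetherBigField K (H × G)))
    (hN : ∀ e ∈ N, e ∈ noetherSubfield K (H × G))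
    (hφN : ∀ u ∈ noetherSubfield K H, φ u ∈ N)
    (hψN : ∀ u ∈ noetherSubfield K G, ψ u ∈ N)
    (t : Set (NoetherBigField K (H × G))) (htN : ∀ y ∈ t, y ∈ N)
    (htop : IntermediateField.adjoin K (Set.range φ ∪ Set.range ψ ∪ t) = ⊤)
    (e : NoetherBigField K (H × G)) (he : e ∈ noetherSubfield K (H × G)) : e ∈ N := by
  classical
  have := Fintype.ofFinite H
  have := Fintype.ofFinite G
  have hφalg : ∀ u, IsAlgebraic N (φ u) := by
    intro u
    have h1 := (nbf_isIntegral K H).isIntegral u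
    let f : noetherSubfield K H →+* N :=
      ((φ : NoetherBigField K H →+* _).comp (noetherSubfield K H).subtype).codRestrict N.toSubfield
        (fun u => hφN u u.2)
    obtain ⟨p, hp, hpu⟩ := h1
    refine IsIntegral.isAlgebraic ⟨p.map f, hp.map f, ?_⟩
    rw [Polynomial.eval₂_map]
    have h2 : (algebraMap N (NoetherBigField K (H × G))).comp f =
      (φ : NoetherBigField K H →+* _).comp (algebraMap (noetherSubfield K H) _) := rfl
    rw [h2]
    have h3 := Polynomial.hom_eval₂ p (algebraMap (noetherSubfield K H) _)
      (φ : NoetherBigField K H →+* NoetherBigField K (H × G)) u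
    rw [hpu, map_zero] at h3
    exact h3.symm
  have hψalg : ∀ u, IsAlgebraic N (ψ u) := by
    intro u
    have h1 := (nbf_isIntegral K G).isIntegral u
    let f : noetherSubfield K G →+* N :=
      ((ψ : NoetherBigField K G →+* _).comp (noetherSubfield K G).subtype).codRestrict N.toSubfield
        (fun u => hψN u u.2)
    obtain ⟨p, hp, hpu⟩ := h1
    refine IsIntegral.isAlgebraic ⟨p.map f, hp.map f, ?_⟩
    rw [Polynomial.eval₂_map]
    have h2 : (algebraMap N (NoetherBigField K (H × G))).comp f =
      (ψ : NoetherBigField K G →+* _).comp (algebraMap (noetherSubfield K G) _) := rfl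
    rw [h2]
    have h3 := Polynomial.hom_eval₂ p (algebraMap (noetherSubfield K G) _)
      (ψ : NoetherBigField K G →+* NoetherBigField K (H × G)) u
    rw [hpu, map_zero] at h3
    exact h3.symm
  have hNtop : IntermediateField.adjoin N (Set.range φ ∪ Set.range ψ) = ⊤ := by
    have h1 : (IntermediateField.adjoin N (Set.range φ ∪ Set.range ψ)).restrictScalars K = ⊤ := by
      rw [eq_top_iff, ← htop, IntermediateField.adjoin_le_iff]
      rintro y (hy | hy)
      · exact IntermediateField.subset_adjoin N _ hy
      · exact IntermediateField.algebraMap_mem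
          (IntermediateField.adjoin N (Set.range φ ∪ Set.range ψ)) (⟨y, htN y hy⟩ : N)
    rw [eq_top_iff]
    intro y _
    have : y ∈ (⊤ : IntermediateField K (NoetherBigField K (H × G))) := trivial
    rw [← h1] at this
    exact this
  have halg : Algebra.adjoin N (Set.range φ ∪ Set.range ψ) = ⊤ := by
    rw [← IntermediateField.adjoin_eq_top_iff_of_isAlgebraic]
    · exact hNtop
    · rintro _ (⟨u, rfl⟩ | ⟨u, rfl⟩)
      · exact hφalg u
      · exact hψalg u
  have hcl : ∀ y ∈ Submonoid.closure (Set.range φ ∪ Set.range ψ), ∃ u v, y = φ u * ψ v := by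
    intro y hy
    induction hy using Submonoid.closure_induction with
    | mem y hy =>
      rcases hy with ⟨u, rfl⟩ | ⟨u, rfl⟩
      · exact ⟨u, 1, by simp⟩
      · exact ⟨1, u, by simp⟩
    | one => exact ⟨1, 1, by simp⟩
    | mul p q _ _ hp hq =>
      obtain ⟨u, v, rfl⟩ := hp
      obtain ⟨u', v', rfl⟩ := hq
      exact ⟨u * u', v * v', by simp only [map_mul]; ring⟩
  obtain ⟨c1, hc1⟩ := exists_tr_one K H
  obtain ⟨c2, hc2⟩ := exists_tr_one K G
  have htr : ∀ u v, ∑ γ : H × G, noetherAut K (H × G) γ (φ u * ψ v) =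
      φ (∑ h, noetherAut K H h u) * ψ (∑ g, noetherAut K G g v) := by
    intro u v
    rw [Fintype.sum_prod_type, map_sum, map_sum, Finset.sum_mul_sum]
    simp only [map_mul, hφ, hψ]
  have hmain : ∀ y : NoetherBigField K (H × G),
      ∑ γ : H × G, noetherAut K (H × G) γ (φ c1 * ψ c2 * y) ∈ N := by
    intro y
    have hy : y ∈ Submodule.span N
        (Submonoid.closure (Set.range φ ∪ Set.range ψ) : Set (NoetherBigField K (H × G))) := by
      rw [← Algebra.adjoin_eq_span, halg]
      trivial
    induction hy using Submodule.span_induction with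
    | mem y hy =>
      obtain ⟨u, v, rfl⟩ := hcl y hy
      have : φ c1 * ψ c2 * (φ u * ψ v) = φ (c1 * u) * ψ (c2 * v) := by
        simp only [map_mul]; ring
      rw [this, htr]
      exact mul_mem (hφN _ (tr_mem _ _ _)) (hψN _ (tr_mem _ _ _))
    | zero => simp
    | add p q _ _ hp hq =>
      simp only [mul_add, map_add, Finset.sum_add_distrib]
      simp only [map_mul] at hp hq ⊢
      exact add_mem hp hq
    | smul n p _ hp =>
      have : ∑ γ : H × G, noetherAut K (H × G) γ (φ c1 * ψ c2 * (n • p)) =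
          n * ∑ γ : H × G, noetherAut K (H × G) γ (φ c1 * ψ c2 * p) := by
        rw [Finset.mul_sum]
        refine Finset.sum_congr rfl fun γ _ => ?_
        rw [IntermediateField.smul_def, smul_eq_mul]
        have h1 : φ c1 * ψ c2 * ((n : NoetherBigField K (H × G)) * p) = n * (φ c1 * ψ c2 * p) := by ring
        rw [h1, map_mul, hN n n.2 γ]
      rw [this]
      exact mul_mem n.2 hp
  have hfin := hmain e
  have h1 : ∑ γ : H × G, noetherAut K (H × G) γ (φ c1 * ψ c2 * e) = e := by
    have : ∀ γ, noetherAut K (H × G) γ (φ c1 * ψ c2 * e) =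
        noetherAut K (H × G) γ (φ c1 * ψ c2) * e := by
      intro γ
      rw [map_mul, he γ]
    simp only [this]
    rw [← Finset.sum_mul, htr, hc1, hc2]
    simp
  rwa [h1] at hfin

/-- The inclusion of the fixed field. -/
def nincl (K : Type*) [Field K] (G : Type*) [Group G] :
    NoetherField K G →ₐ[K] NoetherBigField K G :=
  { (noetherSubfield K G).subtype with
    commutes' := fun _ => rfl }

theorem nincl_mem (K : Type*) [Field K] (G : Type*) [Group G] (u : NoetherField K G) :
    nincl K G u ∈ noetherSubfield K G := u.2

theorem nincl_inj (K : Type*) [Field K] (G : Type*) [Group G] :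
    Function.Injective (nincl K G) := Subtype.val_injective

/-- Restriction to fixed fields. -/
def nmk (K : Type*) [Field K] (G : Type*) [Group G] (x : NoetherBigField K G)
    (hx : x ∈ noetherSubfield K G) : NoetherField K G := ⟨x, hx⟩

theorem nincl_nmk (K : Type*) [Field K] (G : Type*) [Group G] (x : NoetherBigField K G)
    (hx : x ∈ noetherSubfield K G) : nincl K G (nmk K G x hx) = x := rfl

theorem trdeg_noetherField (K : Type*) [Field K] (G : Type*) [Group G] [Finite G] :
    Algebra.trdeg K (NoetherField K G) = (Nat.card G : Cardinal) := by
  let : Algebra (NoetherField K G) (NoetherBigField K G) := (nincl K G).toRingHom.toAlgebra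
  have : IsScalarTower K (NoetherField K G) (NoetherBigField K G) :=
    IsScalarTower.of_algebraMap_eq fun _ => rfl
  have h1 : Algebra.IsIntegral (NoetherField K G) (NoetherBigField K G) := nbf_isIntegral K G
  have h2 : Algebra.IsAlgebraic (NoetherField K G) (NoetherBigField K G) := inferInstance
  have h3 := trdeg_add_eq K (NoetherField K G) (A := NoetherBigField K G)
  rw [trdeg_eq_zero (R := NoetherField K G), add_zero, trdeg_nbf] at h3
  exact h3

/-- Lift of an algebraically independent family. -/
theorem exists_lift (K : Type*) [Field K] (I L : Type*) [Field L] [Algebra K L] (a : I → L)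
    (ha : AlgebraicIndependent K a) : ∃ φ : NoetherBigField K I →ₐ[K] L,
      (∀ i, φ (nvar K I i) = a i) ∧ φ.fieldRange = IntermediateField.adjoin K (Set.range a) := by
  refine ⟨IsFractionRing.liftAlgHom (g := MvPolynomial.aeval a)
    (algebraicIndependent_iff_injective_aeval.1 ha), ?_, ?_⟩
  · intro i
    simp [nvar]
  · exact IsFractionRing.liftAlgHom_fieldRange_eq_of_range_eq _
      (Algebra.adjoin_range_eq_range_aeval K a).symm

/-- Restriction of an equivariant embedding to fixed fields. -/
theorem exists_restrict (K : Type*) [Field K] (H Γ : Type*) [Group H] [Group Γ]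
    (φ : NoetherBigField K H →ₐ[K] NoetherBigField K Γ)
    (h : ∀ u ∈ noetherSubfield K H, φ u ∈ noetherSubfield K Γ) :
    ∃ α : NoetherField K H →ₐ[K] NoetherField K Γ, ∀ u, nincl K Γ (α u) = φ (nincl K H u) :=
  ⟨{ toFun := fun u => nmk K Γ (φ (nincl K H u)) (h _ u.2)
     map_one' := by apply nincl_inj; rw [nincl_nmk]; simp
     map_mul' := fun x y => by apply nincl_inj; rw [nincl_nmk, map_mul, map_mul, map_mul]; rfl
     map_zero' := by apply nincl_inj; rw [nincl_nmk]; simp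
     map_add' := fun x y => by apply nincl_inj; rw [nincl_nmk, map_add, map_add, map_add]; rfl
     commutes' := fun r => by apply nincl_inj; rw [nincl_nmk, AlgHom.commutes, AlgHom.commutes, AlgHom.commutes] },
    fun _ => rfl⟩

/-- Step 3 of the proof of Theorem 1.9: `K(H × G)` is rational over a free composite of copies
of `K(H)` and `K(G)`: there are `K`-embeddings `α : K(H) → K(H × G)` and `β : K(G) → K(H × G)`
whose images generate a compositum `F = α(K(H)) · β(K(G))` of transcendence degree
`|H| + |G|` over `K` (witnessed by a transcendence basis of that cardinality), and
`K(H × G)` is rational over `F`. -/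
theorem noether_rational_over_free_composite
    (K : Type*) [Field K] (H G : Type*) [Group H] [Group G] [Finite H] [Finite G]
    [Nontrivial H] [Nontrivial G] :
    ∃ (α : NoetherField K H →ₐ[K] NoetherField K (H × G))
      (β : NoetherField K G →ₐ[K] NoetherField K (H × G))
      (s : Set ↥(α.fieldRange ⊔ β.fieldRange)),
        IsTranscendenceBasis K ((↑) : s → ↥(α.fieldRange ⊔ β.fieldRange)) ∧
        Nat.card s = Nat.card H + Nat.card G ∧
        IsRationalExtension ↥(α.fieldRange ⊔ β.fieldRange) (NoetherField K (H × G)) := by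
  classical
  obtain ⟨a, b, k, t, ha, hb, ht, hcard, htop⟩ := main_one K H G
  have hz : AlgebraicIndependent K (Sum.elim (Sum.elim a b) t) := by
    have htop' : IntermediateField.adjoin K (Set.range (Sum.elim (Sum.elim a b) t)) = ⊤ := by
      rw [Set.Sum.elim_range, Set.Sum.elim_range]; exact htop
    have := isAlgebraic_of_adjoin_eq_top htop'
    refine (Algebra.IsAlgebraic.isTranscendenceBasis_of_lift_le_trdeg_of_finite K
      (Sum.elim (Sum.elim a b) t) ?_).1
    rw [trdeg_nbf, ← Nat.cast_card, Cardinal.lift_natCast, Cardinal.lift_natCast, Nat.cast_le,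
      Nat.card_sum, Nat.card_sum, Nat.card_fin]
    exact hcard
  have hab : AlgebraicIndependent K (Sum.elim a b) := by
    have := hz.comp Sum.inl Sum.inl_injective
    simpa using this
  have haI : AlgebraicIndependent K a := by
    have := hab.comp Sum.inl Sum.inl_injective
    simpa using this
  have hbI : AlgebraicIndependent K b := by
    have := hab.comp Sum.inr Sum.inr_injective
    simpa using this
  obtain ⟨φ, hφX, hφR⟩ := exists_lift K H _ a haI
  obtain ⟨ψ, hψX, hψR⟩ := exists_lift K G _ b hbI
  have hφ : ∀ h g u, noetherAut K (H × G) (h, g) (φ u) = φ (noetherAut K H h u) := by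
    intro h g u
    have : (noetherAut K (H × G) (h, g) : NoetherBigField K (H × G) →ₐ[K] _).comp φ =
        φ.comp (noetherAut K H h : NoetherBigField K H →ₐ[K] _) := by
      apply nbf_ext
      intro i
      show noetherAut K (H × G) (h, g) (φ (nvar K H i)) = φ (noetherAut K H h (nvar K H i))
      rw [noetherAut_nvar, hφX, hφX, ha]
    exact DFunLike.congr_fun this u
  have hψ : ∀ h g u, noetherAut K (H × G) (h, g) (ψ u) = ψ (noetherAut K G g u) := by
    intro h g u
    have : (noetherAut K (H × G) (h, g) : NoetherBigField K (H × G) →ₐ[K] _).comp ψ =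
        ψ.comp (noetherAut K G g : NoetherBigField K G →ₐ[K] _) := by
      apply nbf_ext
      intro i
      show noetherAut K (H × G) (h, g) (ψ (nvar K G i)) = ψ (noetherAut K G g (nvar K G i))
      rw [noetherAut_nvar, hψX, hψX, hb]
    exact DFunLike.congr_fun this u
  obtain ⟨α, hα⟩ := exists_restrict K H (H × G) φ (fun u hu γ => by rw [hφ, hu])
  obtain ⟨β, hβ⟩ := exists_restrict K G (H × G) ψ (fun u hu γ => by rw [hψ, hu])
  let t' : Fin k → NoetherField K (H × G) := fun i => nmk K (H × G) (t i) (fun γ => ht γ i)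
  let F : IntermediateField K (NoetherField K (H × G)) := α.fieldRange ⊔ β.fieldRange
  have hgen : IntermediateField.adjoin F (Set.range t') = ⊤ := by
    rw [eq_top_iff]
    intro e _
    have key := fixed_mem K H G φ ψ hφ hψ
      (((IntermediateField.adjoin F (Set.range t')).restrictScalars K).map (nincl K (H × G)))
      (by rintro _ ⟨y, _, rfl⟩; exact nincl_mem _ _ _)
      (by
        intro u hu
        refine ⟨α (nmk K H u hu), ?_, hα _⟩
        exact IntermediateField.algebraMap_mem (IntermediateField.adjoin F (Set.range t'))
          (⟨α (nmk K H u hu), (le_sup_left : α.fieldRange ≤ F) ⟨_, rfl⟩⟩ : F))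
      (by
        intro u hu
        refine ⟨β (nmk K G u hu), ?_, hβ _⟩
        exact IntermediateField.algebraMap_mem (IntermediateField.adjoin F (Set.range t'))
          (⟨β (nmk K G u hu), (le_sup_right : β.fieldRange ≤ F) ⟨_, rfl⟩⟩ : F))
      (Set.range t)
      (by
        rintro _ ⟨i, rfl⟩
        exact ⟨t' i, IntermediateField.subset_adjoin F _ ⟨i, rfl⟩, rfl⟩)
      (by
        rw [eq_top_iff, ← htop]
        apply IntermediateField.adjoin.mono
        apply Set.union_subset_union_left
        apply Set.union_subset_union
        · rintro _ ⟨i, rfl⟩; exact ⟨_, hφX i⟩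
        · rintro _ ⟨i, rfl⟩; exact ⟨_, hψX i⟩)
      (nincl K (H × G) e) (nincl_mem _ _ _)
    obtain ⟨y, hy, hye⟩ := key
    rw [← nincl_inj _ _ hye]
    exact hy
  have hadd := trdeg_add_eq K F (A := NoetherField K (H × G))
  rw [trdeg_noetherField] at hadd
  have hAlg := isAlgebraic_of_adjoin_eq_top hgen
  have hle1 : Algebra.trdeg F (NoetherField K (H × G)) ≤ (k : Cardinal) := by
    refine (Algebra.IsAlgebraic.trdeg_le_cardinalMk F (Set.range t')).trans ?_
    have := Cardinal.mk_range_le_lift (f := t')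
    simpa using this
  have hle2 : Algebra.trdeg K F ≤ ((Nat.card H + Nat.card G : ℕ) : Cardinal) := by
    let C := IntermediateField.adjoin K (Set.range (Sum.elim a b))
    have hFC : F ≤ C.comap (nincl K (H × G)) := by
      apply sup_le
      · rintro _ ⟨u, rfl⟩
        show nincl K (H × G) (α u) ∈ C
        rw [hα]
        have : φ (nincl K H u) ∈ φ.fieldRange := ⟨_, rfl⟩
        rw [hφR] at this
        refine IntermediateField.adjoin.mono _ _ _ ?_ this
        rw [Set.Sum.elim_range]
        exact Set.subset_union_left
      · rintro _ ⟨u, rfl⟩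
        show nincl K (H × G) (β u) ∈ C
        rw [hβ]
        have : ψ (nincl K G u) ∈ ψ.fieldRange := ⟨_, rfl⟩
        rw [hψR] at this
        refine IntermediateField.adjoin.mono _ _ _ ?_ this
        rw [Set.Sum.elim_range]
        exact Set.subset_union_right
    let ν : F →ₐ[K] C := ((nincl K (H × G)).comp F.val).codRestrict C.toSubalgebra
      (fun y => hFC y.2)
    let μ : F →ₐ[K] NoetherBigField K (H ⊕ G) :=
      (hab.aevalEquivField.symm : C →ₐ[K] NoetherBigField K (H ⊕ G)).comp ν
    refine (trdeg_le_of_injective μ μ.toRingHom.injective).trans ?_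
    rw [trdeg_nbf, Nat.card_sum]
  obtain ⟨d, hd⟩ := Cardinal.lt_aleph0.1 (hle1.trans_lt Cardinal.natCast_lt_aleph0)
  obtain ⟨f, hf⟩ := Cardinal.lt_aleph0.1 (hle2.trans_lt Cardinal.natCast_lt_aleph0)
  rw [hd, Nat.cast_le] at hle1
  rw [hf, Nat.cast_le] at hle2
  rw [hd, hf, ← Nat.cast_add, Nat.cast_inj] at hadd
  have hdk : d = k := by omega
  have hfk : f = Nat.card H + Nat.card G := by omega
  obtain ⟨s, hs⟩ := exists_isTranscendenceBasis K F
  refine ⟨α, β, s, hs, ?_, k, ⟨?_⟩⟩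
  · have h1 := hs.cardinalMk_eq_trdeg
    rw [hf, hfk] at h1
    rw [Nat.card, h1, Cardinal.toNat_natCast]
  · have hT : IsTranscendenceBasis F t' := by
      refine Algebra.IsAlgebraic.isTranscendenceBasis_of_lift_le_trdeg_of_finite F t' ?_
      rw [hd, hdk]
      simp
    exact ((hT.1.aevalEquivField.trans (IntermediateField.equivOfEq hgen)).trans
      IntermediateField.topEquiv).symm

end
end

section
/- Let K be any field and n an odd positive integer. If K(Z/nZ) is rational (purely transcendental) over K, then K(D_{2n}) is stably rational over K. -/
set_option synthInstance.maxHeartbeats 1000000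
set_option maxHeartbeats 1000000

noncomputable section

namespace NDS
open IntermediateField

/-- Galois descent: every vector lies in the span of its twisted traces. -/
theorem mem_span_trace {E Γ : Type*} [Field E] [Group Γ] [Fintype Γ] [MulSemiringAction Γ E]
    (L : Subfield E) (hL : ∀ (g : Γ), ∀ a ∈ L, g • a ∈ L)
    (hf : ∀ g h : Γ, (∀ a ∈ L, g • a = h • a) → g = h) (v : E) :
    v ∈ Submodule.span L (Set.range fun a : L => ∑ g : Γ, g • ((a : E) * v)) := by
  by_contra hv
  obtain ⟨φ, hφv, hφ⟩ := Submodule.exists_le_ker_of_notMem hv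
  apply hφv
  let ch : Γ → (L →* E) := fun g =>
    { toFun := fun a => g • (a : E)
      map_one' := by simp
      map_mul' := by intro a b; simp [smul_mul'] }
  have hch : Function.Injective ch := by
    intro g h hgh
    apply hf
    intro a ha
    exact congrArg (fun f : L →* E => f ⟨a, ha⟩) hgh
  have hli := (linearIndependent_monoidHom L E).comp ch hch
  rw [Fintype.linearIndependent_iff] at hli
  have key := hli (fun g => ((φ (g • v) : L) : E)) (by
    ext a
    have h1 : φ (∑ g : Γ, g • ((a : E) * v)) = 0 := by
      have := hφ (Submodule.subset_span ⟨a, rfl⟩)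
      simpa using this
    rw [map_sum] at h1
    have h2 : ∀ g : Γ, φ (g • ((a : E) * v)) = ⟨g • (a : E), hL g a a.2⟩ * φ (g • v) := by
      intro g
      rw [smul_mul']
      exact φ.map_smul ⟨g • (a : E), hL g a a.2⟩ (g • v)
    simp only [h2] at h1
    have h3 := congrArg (fun t : L => (t : E)) h1
    simp only [Function.comp, Finset.sum_apply, Pi.smul_apply, smul_eq_mul, Pi.zero_apply]
    refine Eq.trans ?_ (h3.trans rfl)
    rw [AddSubmonoidClass.coe_finsetSum]
    apply Finset.sum_congr rfl
    intro g _
    rw [mul_comm]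
    rfl) 1
  simpa using key

theorem nn {K E Γ X Y : Type*} [Field K] [Field E] [Algebra K E] [Group Γ] [Fintype Γ]
    [MulSemiringAction Γ E] [SMulCommClass Γ K E] [MulAction Γ X] [MulAction Γ Y] [Finite Y]
    [FaithfulSMul Γ X] (xv : X → E) (hx : Function.Injective xv) (yv : Y → E)
    (hxv : ∀ (g : Γ) i, g • xv i = xv (g • i)) (hyv : ∀ (g : Γ) i, g • yv i = yv (g • i)) :
    ∃ y : Y → E, (∀ (g : Γ) j, g • y j = y j) ∧
      ∀ F : Subfield E, (∀ c : K, algebraMap K E c ∈ F) → (∀ i, xv i ∈ F) → (∀ j, y j ∈ F) →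
        ∀ j, yv j ∈ F := by
  classical
  have := Fintype.ofFinite Y
  let L : Subfield E := (adjoin K (Set.range xv)).toSubfield
  have hmem : ∀ i, xv i ∈ L := fun i => subset_adjoin K _ ⟨i, rfl⟩
  have hL : ∀ (g : Γ), ∀ a ∈ L, g • a ∈ L := by
    intro g a ha
    have : adjoin K (Set.range xv) ≤
        (adjoin K (Set.range xv)).comap (MulSemiringAction.toAlgHom K E g) := by
      rw [adjoin_le_iff]
      rintro _ ⟨i, rfl⟩
      change g • xv i ∈ adjoin K (Set.range xv)
      rw [hxv]
      exact subset_adjoin K _ ⟨_, rfl⟩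
    exact this ha
  have hf : ∀ g h : Γ, (∀ a ∈ L, g • a = h • a) → g = h := by
    intro g h hgh
    apply FaithfulSMul.eq_of_smul_eq_smul (α := X)
    intro i
    apply hx
    rw [← hxv, ← hxv]
    exact hgh _ (hmem i)
  let V : Submodule L E := Submodule.span L (Set.range yv)
  let S : Set E := {s | s ∈ V ∧ ∀ g : Γ, g • s = s}
  have hVst : ∀ (g : Γ), ∀ v ∈ V, g • v ∈ V := by
    intro g v hv
    induction hv using Submodule.span_induction with
    | mem x h =>
      obtain ⟨i, rfl⟩ := h
      rw [hyv]; exact Submodule.subset_span ⟨_, rfl⟩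
    | zero => simp
    | add x y _ _ h1 h2 => rw [smul_add]; exact V.add_mem h1 h2
    | smul a x _ h =>
      have : g • (a • x) = (⟨g • (a : E), hL g a a.2⟩ : L) • (g • x) := by
        change g • ((a : E) * x) = (g • (a : E)) * (g • x)
        rw [smul_mul']
      rw [this]; exact V.smul_mem _ h
  have hS : ∀ j, yv j ∈ Submodule.span L S := by
    intro j
    refine Submodule.span_mono ?_ (mem_span_trace (Γ := Γ) L hL hf (yv j))
    rintro _ ⟨a, rfl⟩
    refine ⟨V.sum_mem fun g _ => hVst g _ (V.smul_mem a (Submodule.subset_span ⟨j, rfl⟩)), ?_⟩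
    intro h
    rw [Finset.smul_sum]
    simp only [smul_smul]
    exact Fintype.sum_equiv (Equiv.mulLeft h) _ _ (fun g => rfl)
  obtain ⟨b, hbS, hbspan, hbli⟩ := exists_linearIndependent L S
  have hbV : ∀ s : b, (s : E) ∈ V := fun s => (hbS s.2).1
  have : Module.Finite L V := Module.Finite.span_of_finite L (Set.finite_range yv)
  have hbli' : LinearIndependent L (fun s : b => (⟨s, hbV s⟩ : V)) := by
    apply LinearIndependent.of_comp V.subtype
    exact hbli
  have : Finite b := hbli'.finite
  have := Fintype.ofFinite b
  have hcard : Fintype.card b ≤ Fintype.card Y :=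
    hbli'.fintype_card_le_finrank.trans (finrank_range_le_card yv)
  obtain ⟨e⟩ := Function.Embedding.nonempty_of_card_le hcard
  refine ⟨fun j => if h : ∃ s, e s = j then (h.choose : E) else 0, ?_, ?_⟩
  · intro g j
    dsimp only
    split_ifs with h
    · exact (hbS h.choose.2).2 g
    · simp
  · intro F hK hxF hyF j
    have hLF : L ≤ F := by
      let F' : IntermediateField K E := F.toIntermediateField hK
      have : adjoin K (Set.range xv) ≤ F' := by
        rw [adjoin_le_iff]; rintro _ ⟨i, rfl⟩; exact hxF i
      exact this
    have hbF : ∀ s : b, (s : E) ∈ F := by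
      intro s
      have := hyF (e s)
      dsimp only at this
      have hex : ∃ s', e s' = e s := ⟨s, rfl⟩
      rw [dif_pos hex] at this
      rwa [e.injective hex.choose_spec] at this
    have h1 := hS j
    rw [← hbspan] at h1
    generalize yv j = w at h1
    induction h1 using Submodule.span_induction with
    | mem x h => exact hbF ⟨x, h⟩
    | zero => exact F.zero_mem
    | add x y _ _ h1 h2 => exact F.add_mem h1 h2
    | smul a x _ h => exact F.mul_mem (hLF a.2) h

theorem rank_step {E : Type*} [Field E] (A0 A F : Subfield E) (h0 : A0 ≤ A) (hF : A0 ≤ F)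
    (d e : ℕ) (hd : Subfield.relrank A0 A ≤ d) (he : Module.rank ↥(F ⊔ A) E ≤ e) :
    Module.rank F E ≤ (d * e : ℕ) := by
  let : Algebra A0 F := (Subfield.inclusion hF).toAlgebra
  have : IsScalarTower A0 F E := IsScalarTower.of_algebraMap_eq (fun _ => rfl)
  rw [Subfield.relrank_eq_rank_of_le h0] at hd
  have : Module.Finite A0 (Subfield.extendScalars h0) :=
    Module.rank_lt_aleph0_iff.mp (hd.trans_lt (Cardinal.natCast_lt_aleph0))
  have h1 := IntermediateField.adjoin_rank_le_of_isAlgebraic_right F (Subfield.extendScalars h0)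
  have h2 : IntermediateField.adjoin F ((Subfield.extendScalars h0 : IntermediateField A0 E) : Set E)
      = Subfield.extendScalars (le_sup_left : F ≤ F ⊔ A) := by
    apply le_antisymm
    · rw [adjoin_le_iff]
      intro x hx
      exact (le_sup_right : A ≤ F ⊔ A) hx
    · intro x hx
      have : F ⊔ A ≤ (IntermediateField.adjoin F
          ((Subfield.extendScalars h0 : IntermediateField A0 E) : Set E)).toSubfield := by
        apply sup_le
        · intro x hx
          exact (IntermediateField.adjoin F _).algebraMap_mem ⟨x, hx⟩
        · intro x hx
          exact subset_adjoin F _ hx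
      exact this hx
  rw [h2] at h1
  rw [← Subfield.relrank_mul_rank_top (le_sup_left : F ≤ F ⊔ A),
    Subfield.relrank_eq_rank_of_le (le_sup_left : F ≤ F ⊔ A)]
  push_cast
  exact mul_le_mul' (h1.trans hd) he

theorem quad_step {E : Type*} [Field E] (F : Subfield E) (a b : E) (h1 : a + b ∈ F) (h2 : a * b ∈ F)
    (e : ℕ) (M : Subfield E) (hM : M ≤ (IntermediateField.adjoin F {a}).toSubfield)
    (hFM : F ≤ M) (haM : a ∈ M)
    (he : Module.rank M E ≤ e) :
    Module.rank F E ≤ (2 * e : ℕ) := by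
  have hME : M = (IntermediateField.adjoin F {a}).toSubfield := by
    apply le_antisymm hM
    have : IntermediateField.adjoin F {a} ≤ Subfield.extendScalars hFM := by
      rw [adjoin_le_iff]; rintro _ rfl; exact haM
    exact this
  let p : Polynomial F := Polynomial.X ^ 2 + Polynomial.C (-⟨a + b, h1⟩) * Polynomial.X
    + Polynomial.C ⟨a * b, h2⟩
  have hdeg : p.natDegree = 2 := by
    have := Polynomial.natDegree_quadratic (R := F) (a := 1) (b := -⟨a + b, h1⟩) (c := ⟨a * b, h2⟩)
      one_ne_zero
    simpa [p] using this
  have hp0 : p ≠ 0 := by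
    intro h; rw [h] at hdeg; simp at hdeg
  have hroot : Polynomial.aeval a p = 0 := by
    simp only [p, map_add, map_mul, map_pow, Polynomial.aeval_X, Polynomial.aeval_C]
    change a ^ 2 + (-(a + b)) * a + a * b = 0
    ring
  have hint : IsIntegral F a := IsAlgebraic.isIntegral ⟨p, hp0, hroot⟩
  have : FiniteDimensional F (IntermediateField.adjoin F {a}) := adjoin.finiteDimensional hint
  have hfr : Module.finrank F (IntermediateField.adjoin F {a}) ≤ 2 := by
    rw [adjoin.finrank hint, ← hdeg]
    exact Polynomial.natDegree_le_of_dvd (minpoly.dvd F a hroot) hp0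
  rw [hME] at he
  have h3 := rank_mul_rank F (IntermediateField.adjoin F {a}) E
  rw [← h3, ← Module.finrank_eq_rank]
  push_cast
  exact mul_le_mul' (by exact_mod_cast hfr) he

end NDS

namespace NDS
open IntermediateField

open scoped IntermediateField.algebraAdjoinAdjoin in
theorem algInd_of_gens {F : Type*} {E : Type*} {ι : Type*} [Field F] [Field E] [Algebra F E] [Finite ι]
    (f : ι → E) (hfin : Algebra.IsAlgebraic (IntermediateField.adjoin F (Set.range f)) E)
    (hcard : (Nat.card ι : Cardinal) ≤ Algebra.trdeg F E) : AlgebraicIndependent F f := by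
  have : Algebra.IsAlgebraic (Algebra.adjoin F (Set.range f)) E :=
    (IsFractionRing.comap_isAlgebraic_iff (A := Algebra.adjoin F (Set.range f))
      (K := IntermediateField.adjoin F (Set.range f)) (C := E)).mpr hfin
  refine (Algebra.IsAlgebraic.isTranscendenceBasis_of_lift_le_trdeg_of_finite F f ?_).1
  have h : Cardinal.mk ι = Nat.card ι := (Nat.cast_card).symm
  rw [h]
  simpa using hcard

theorem stab {K F E : Type*} {ι κ : Type*} [Finite ι] [Finite κ] [Field K] [Field F] [Field E]
    [Algebra K F] [Algebra F E]
    [Algebra K E] [IsScalarTower K F E] (f : ι → E) (g : κ → E) (hf : AlgebraicIndependent F f)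
    (hg : AlgebraicIndependent K g)
    (h : ∀ x, x ∈ IntermediateField.adjoin F (Set.range f) ↔
      x ∈ IntermediateField.adjoin K (Set.range g)) :
    IsStablyRationalExtension K F := by
  let e1 := (Finite.equivFin ι).symm
  let e2 := (Finite.equivFin κ).symm
  have hf' : AlgebraicIndependent F (f ∘ e1) := hf.comp _ e1.injective
  have hg' : AlgebraicIndependent K (g ∘ e2) := hg.comp _ e2.injective
  have h1 := hf'.aevalEquivField
  have h2 := hg'.aevalEquivField
  rw [e1.surjective.range_comp] at h1
  rw [e2.surjective.range_comp] at h2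
  refine ⟨Nat.card ι, Nat.card κ, ⟨?_⟩⟩
  let e3 : (IntermediateField.adjoin F (Set.range f)) ≃ₐ[K] (IntermediateField.adjoin K (Set.range g)) :=
    { toFun := fun x => ⟨x, (h x).1 x.2⟩
      invFun := fun x => ⟨x, (h x).2 x.2⟩
      left_inv := fun x => rfl
      right_inv := fun x => rfl
      map_mul' := fun x y => rfl
      map_add' := fun x y => rfl
      commutes' := fun c => rfl }
  exact ((h1.restrictScalars K).trans e3).trans h2.symm

/-- The variables. -/
abbrev var (K : Type*) [Field K] {A : Type*} (a : A) : NoetherBigField K A :=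
  algebraMap (MvPolynomial A K) (FractionRing (MvPolynomial A K)) (MvPolynomial.X a)

theorem var_injective (K : Type*) [Field K] {A : Type*} :
    Function.Injective (var K : A → NoetherBigField K A) :=
  (IsFractionRing.injective (MvPolynomial A K) (FractionRing (MvPolynomial A K))).comp
    (MvPolynomial.X_injective)

theorem hom_ext {K : Type*} [Field K] {A : Type*} {E : Type*} [Field E] [Algebra K E]
    {f g : NoetherBigField K A →ₐ[K] E} (h : ∀ a, f (var K a) = g (var K a)) : f = g := by
  apply IsLocalization.algHom_ext (nonZeroDivisors (MvPolynomial A K))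
  apply MvPolynomial.algHom_ext
  intro a
  exact h a

theorem algEquiv_var (K : Type*) [Field K] {Z : Type*} (s : Equiv.Perm Z) (z : Z) :
    (IsFractionRing.algEquivOfAlgEquiv (MvPolynomial.renameEquiv K s) :
      NoetherBigField K Z ≃ₐ[K] NoetherBigField K Z) (var K z) = var K (s z) :=
  (IsFractionRing.algEquivOfAlgEquiv_algebraMap (MvPolynomial.renameEquiv K s)
    (MvPolynomial.X z)).trans
    (congrArg (algebraMap _ _) (MvPolynomial.rename_X s z))

theorem equiv_ext {K : Type*} [Field K] {A : Type*}
    {f g : NoetherBigField K A ≃ₐ[K] NoetherBigField K A}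
    (h : ∀ a, f (var K a) = g (var K a)) : f = g := by
  apply AlgEquiv.coe_toAlgHom_injective
  apply hom_ext
  intro a
  exact h a

def actHom (K : Type*) [Field K] (Γ Z : Type*) [Group Γ] [MulAction Γ Z] :
    Γ →* (NoetherBigField K Z ≃ₐ[K] NoetherBigField K Z) where
  toFun g := IsFractionRing.algEquivOfAlgEquiv (MvPolynomial.renameEquiv K (MulAction.toPerm g))
  map_one' := by
    apply equiv_ext
    intro a
    refine (algEquiv_var K _ a).trans ?_
    exact congrArg (var K) (one_smul Γ a)
  map_mul' g h := by
    apply equiv_ext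
    intro a
    refine (algEquiv_var K _ a).trans ?_
    rw [AlgEquiv.mul_apply]
    refine Eq.trans ?_ (congrArg (IsFractionRing.algEquivOfAlgEquiv
      (MvPolynomial.renameEquiv K (MulAction.toPerm g)) :
      NoetherBigField K Z ≃ₐ[K] NoetherBigField K Z)
      (algEquiv_var K (MulAction.toPerm h) a)).symm
    refine Eq.trans ?_ (algEquiv_var K (MulAction.toPerm g) _).symm
    exact congrArg (var K) (mul_smul g h a)

theorem actHom_var (K : Type*) [Field K] (Γ Z : Type*) [Group Γ] [MulAction Γ Z] (g : Γ) (z : Z) :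
    actHom K Γ Z g (var K z) = var K (g • z) :=
  algEquiv_var K (MulAction.toPerm g) z

theorem actHom_eq_noetherAut (K : Type*) [Field K] (G : Type*) [Group G] (g : G) :
    actHom K G G g = noetherAut K G g := rfl

@[reducible] def actInst (K : Type*) [Field K] (Γ Z : Type*) [Group Γ] [MulAction Γ Z] :
    MulSemiringAction Γ (NoetherBigField K Z) :=
  MulSemiringAction.compHom _ (actHom K Γ Z)

theorem rank_noether (K : Type*) [Field K] (G : Type*) [Group G] [Fintype G] :
    Module.rank (noetherSubfield K G) (NoetherBigField K G) ≤ Fintype.card G := by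
  let := actInst K G G
  have h : noetherSubfield K G = FixedPoints.subfield G (NoetherBigField K G) := by
    ext x; rfl
  rw [h]
  exact FixedPoints.rank_le_card G _

def emb (K : Type*) [Field K] {A B : Type*} (j : A → B) (hj : Function.Injective j) :
    NoetherBigField K A →ₐ[K] NoetherBigField K B :=
  IsFractionRing.liftAlgHom (g := (IsScalarTower.toAlgHom K (MvPolynomial B K)
    (FractionRing (MvPolynomial B K))).comp (MvPolynomial.rename j))
    ((IsFractionRing.injective (MvPolynomial B K) (FractionRing (MvPolynomial B K))).comp
      (MvPolynomial.rename_injective j hj))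

theorem emb_var (K : Type*) [Field K] {A B : Type*} (j : A → B) (hj : Function.Injective j) (a : A) :
    emb K j hj (var K a) = var K (j a) := by
  refine (IsFractionRing.lift_algebraMap (g := ((IsScalarTower.toAlgHom K (MvPolynomial B K)
    (FractionRing (MvPolynomial B K))).comp (MvPolynomial.rename j)).toRingHom) ((IsFractionRing.injective (MvPolynomial B K) (FractionRing (MvPolynomial B K))).comp
      (MvPolynomial.rename_injective j hj)) (MvPolynomial.X a)).trans ?_
  exact congrArg (algebraMap (MvPolynomial B K) (FractionRing (MvPolynomial B K)))
    (MvPolynomial.rename_X j a)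

theorem actHom_emb (K : Type*) [Field K] {Γ Z A : Type*} [Group Γ] [MulAction Γ Z] [Group A]
    (j j' : A → Z) (hj : Function.Injective j) (hj' : Function.Injective j') (g : Γ) (h : A)
    (hgh : ∀ a, g • j a = j' (h * a)) (p : NoetherBigField K A) (hp : p ∈ noetherSubfield K A) :
    actHom K Γ Z g (emb K j hj p) = emb K j' hj' p := by
  have : ((actHom K Γ Z g : NoetherBigField K Z ≃ₐ[K] NoetherBigField K Z) :
      NoetherBigField K Z →ₐ[K] NoetherBigField K Z).comp (emb K j hj) =
      (emb K j' hj').comp ((noetherAut K A h : NoetherBigField K A ≃ₐ[K] NoetherBigField K A) :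
        NoetherBigField K A →ₐ[K] NoetherBigField K A) := by
    apply hom_ext
    intro a
    change actHom K Γ Z g (emb K j hj (var K a)) = emb K j' hj' (noetherAut K A h (var K a))
    rw [emb_var, actHom_var, hgh, ← actHom_eq_noetherAut, actHom_var, emb_var]
    rfl
  have h2 : actHom K Γ Z g (emb K j hj p) = emb K j' hj' (noetherAut K A h p) :=
    DFunLike.congr_fun this p
  rw [h2, hp h]

theorem relrank_emb (K : Type*) [Field K] {A B : Type} [Group A] [Fintype A] (j : A → B)
    (hj : Function.Injective j) :
    Subfield.relrank ((noetherSubfield K A).map (emb K j hj).toRingHom)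
      ((emb K j hj).toRingHom.fieldRange) ≤ Fintype.card A := by
  rw [RingHom.fieldRange_eq_map, Subfield.relrank_map_map, Subfield.relrank_top_right]
  exact rank_noether K A

theorem top_of_var {K : Type*} [Field K] {Z : Type*} (F : Subfield (NoetherBigField K Z))
    (hK : ∀ c : K, algebraMap K _ c ∈ F) (hv : ∀ z, var K z ∈ F) : F = ⊤ := by
  rw [eq_top_iff]
  intro x _
  obtain ⟨a, b, hb, rfl⟩ := IsFractionRing.div_surjective (A := MvPolynomial Z K) x
  have : ∀ a : MvPolynomial Z K, algebraMap _ (FractionRing (MvPolynomial Z K)) a ∈ F := by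
    intro a
    induction a using MvPolynomial.induction_on with
    | C c => exact hK c
    | add p q hp hq => rw [map_add]; exact F.add_mem hp hq
    | mul_X p i hp => rw [map_mul]; exact F.mul_mem hp (hv i)
  exact F.div_mem (this a) (this b)

theorem trdeg_big (K : Type*) [Field K] (Z : Type) [Fintype Z] :
    Algebra.trdeg K (NoetherBigField K Z) = Fintype.card Z := by
  have : Algebra.IsAlgebraic (MvPolynomial Z K) (NoetherBigField K Z) :=
    IsLocalization.isAlgebraic _ (nonZeroDivisors (MvPolynomial Z K))
  have h : IsTranscendenceBasis K (var K : Z → NoetherBigField K Z) := by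
    have := (IsTranscendenceBasis.mvPolynomial Z K)
    exact IsTranscendenceBasis.algebraMap_comp this
  have := h.lift_cardinalMk_eq_trdeg
  simpa using this.symm

end NDS


namespace NDS
open IntermediateField

theorem eq_of_rank {E : Type*} [Field E] (M S : Subfield E) (h : M ≤ S) (N : ℕ) (hN : 0 < N)
    (hS : Module.rank S E = N) (hM : Module.rank M E ≤ N) : M = S := by
  apply le_antisymm h
  rw [← Subfield.relrank_eq_one_iff]
  have h1 := Subfield.relrank_mul_rank_top h
  rw [hS] at h1
  rw [← h1] at hM
  have h2 : Subfield.relrank M S ≤ N := by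
    refine le_trans ?_ hM
    exact le_mul_of_one_le_right' (by exact_mod_cast hN)
  obtain ⟨c, hc⟩ := Cardinal.lt_aleph0.1 (lt_of_le_of_lt h2 (Cardinal.natCast_lt_aleph0))
  have h3 : Subfield.relrank M S ≠ 0 := by
    intro h0
    rw [h0, zero_mul] at h1
    exact (rank_pos (R := M) (M := E)).ne h1
  rw [hc] at hM h3 ⊢
  norm_cast at hM h3 ⊢
  have : c * N ≤ 1 * N := by omega
  have := Nat.le_of_mul_le_mul_right this hN
  omega

theorem core {K F E Γ ι κ : Type*} [Field K] [Field F] [Field E] [Algebra K F] [Algebra F E]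
    [Algebra K E] [IsScalarTower K F E] [Group Γ] [Fintype Γ] [MulSemiringAction Γ E]
    [FaithfulSMul Γ E] [Finite ι] [Finite κ] (f : ι → E) (g : κ → E)
    (hF : ∀ (γ : Γ) (c : F), γ • algebraMap F E c = algebraMap F E c)
    (hf : ∀ (γ : Γ) i, γ • f i = f i) (hg : ∀ (γ : Γ) i, γ • g i = g i)
    (hfr : ∀ M : Subfield E, (∀ c : F, algebraMap F E c ∈ M) → (∀ i, f i ∈ M) →
      Module.rank M E ≤ Fintype.card Γ)
    (hgr : ∀ M : Subfield E, (∀ c : K, algebraMap K E c ∈ M) → (∀ i, g i ∈ M) →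
      Module.rank M E ≤ Fintype.card Γ)
    (hfc : (Nat.card ι : Cardinal) ≤ Algebra.trdeg F E)
    (hgc : (Nat.card κ : Cardinal) ≤ Algebra.trdeg K E) :
    IsStablyRationalExtension K F := by
  have hS : Module.rank (FixedPoints.subfield Γ E) E = (Fintype.card Γ : ℕ) := by
    rw [← FixedPoints.finrank_eq_card Γ E, Module.finrank_eq_rank]
  have r1 := hfr (IntermediateField.adjoin F (Set.range f)).toSubfield
    (fun c => (IntermediateField.adjoin F (Set.range f)).algebraMap_mem c)
    (fun i => IntermediateField.subset_adjoin F _ ⟨i, rfl⟩)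
  have r2 := hgr (IntermediateField.adjoin K (Set.range g)).toSubfield
    (fun c => (IntermediateField.adjoin K (Set.range g)).algebraMap_mem c)
    (fun i => IntermediateField.subset_adjoin K _ ⟨i, rfl⟩)
  have e1 : (IntermediateField.adjoin F (Set.range f)).toSubfield = FixedPoints.subfield Γ E := by
    apply eq_of_rank _ _ _ _ Fintype.card_pos hS r1
    change Subfield.closure _ ≤ _
    rw [Subfield.closure_le]
    rintro _ (⟨c, rfl⟩ | ⟨i, rfl⟩)
    · exact fun γ => hF γ c
    · exact fun γ => hf γ i
  have e2 : (IntermediateField.adjoin K (Set.range g)).toSubfield = FixedPoints.subfield Γ E := by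
    apply eq_of_rank _ _ _ _ Fintype.card_pos hS r2
    change Subfield.closure _ ≤ _
    rw [Subfield.closure_le]
    rintro _ (⟨c, rfl⟩ | ⟨i, rfl⟩)
    · intro γ
      rw [IsScalarTower.algebraMap_apply K F E]
      exact hF γ _
    · exact fun γ => hg γ i
  have f1 : Algebra.IsAlgebraic (IntermediateField.adjoin F (Set.range f)) E := by
    have : Module.Finite (IntermediateField.adjoin F (Set.range f)) E :=
      Module.rank_lt_aleph0_iff.1 (lt_of_le_of_lt r1 Cardinal.natCast_lt_aleph0)
    infer_instance
  have f2 : Algebra.IsAlgebraic (IntermediateField.adjoin K (Set.range g)) E := by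
    have : Module.Finite (IntermediateField.adjoin K (Set.range g)) E :=
      Module.rank_lt_aleph0_iff.1 (lt_of_le_of_lt r2 Cardinal.natCast_lt_aleph0)
    infer_instance
  refine stab f g (algInd_of_gens f f1 hfc) (algInd_of_gens g f2 hgc) ?_
  intro x
  rw [← IntermediateField.mem_toSubfield, e1, ← e2, IntermediateField.mem_toSubfield]

theorem side2 {E : Type*} [Field E] {ι : Type*} (M : Subfield E) (t0 t1 s0 s1 : E)
    (u v : ι → E) (ht : t0 ≠ t1) (h1 : t0 + t1 ∈ M) (h2 : t0 * t1 ∈ M) (h3 : s0 + s1 ∈ M)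
    (h4 : s0 * s1 ∈ M) (h5 : ∀ i, u i + v i ∈ M) (h6 : ∀ i, t0 * u i + t1 * v i ∈ M) (e : ℕ)
    (h : ∀ M' : Subfield E, M ≤ M' → t0 ∈ M' → t1 ∈ M' → s0 ∈ M' → s1 ∈ M' → (∀ i, u i ∈ M') →
      (∀ i, v i ∈ M') → Module.rank M' E ≤ e) :
    Module.rank M E ≤ (2 * (2 * e) : ℕ) := by
  have hle : ∀ (F : Subfield E) (a : E), F ≤ (IntermediateField.adjoin F {a}).toSubfield :=
    fun F a c hc => (IntermediateField.adjoin F {a}).algebraMap_mem ⟨c, hc⟩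
  have hmem : ∀ (F : Subfield E) (a : E), a ∈ (IntermediateField.adjoin F {a}).toSubfield :=
    fun F a => IntermediateField.subset_adjoin F {a} rfl
  refine quad_step M t0 t1 h1 h2 _ _ le_rfl (hle _ _) (hmem _ _) ?_
  set M1 := (IntermediateField.adjoin M {t0}).toSubfield with hM1
  have a1 : M ≤ M1 := hle _ _
  have b1 : t0 ∈ M1 := hmem _ _
  refine quad_step M1 s0 s1 (a1 h3) (a1 h4) _ _ le_rfl (hle _ _) (hmem _ _) ?_
  set M2 := (IntermediateField.adjoin M1 {s0}).toSubfield with hM2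
  have a2 : M1 ≤ M2 := hle _ _
  have b2 : s0 ∈ M2 := hmem _ _
  have t0m := a2 b1
  have t1m : t1 ∈ M2 := by
    have := M2.sub_mem (a2 (a1 h1)) t0m
    rwa [add_sub_cancel_left] at this
  have s1m : s1 ∈ M2 := by
    have := M2.sub_mem (a2 (a1 h3)) b2
    rwa [add_sub_cancel_left] at this
  have vm : ∀ i, v i ∈ M2 := by
    intro i
    have := M2.div_mem (M2.sub_mem (M2.mul_mem t0m (a2 (a1 (h5 i)))) (a2 (a1 (h6 i))))
      (M2.sub_mem t0m t1m)
    have e : (t0 * (u i + v i) - (t0 * u i + t1 * v i)) / (t0 - t1) = v i := by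
      have := sub_ne_zero.2 ht
      field_simp
      ring
    rwa [e] at this
  have um : ∀ i, u i ∈ M2 := by
    intro i
    have := M2.sub_mem (a2 (a1 (h5 i))) (vm i)
    rwa [add_sub_cancel_right] at this
  exact h M2 (a1.trans a2) t0m t1m b2 s1m um vm

end NDS


namespace NDS
open IntermediateField DihedralGroup

theorem cyc_gens (K : Type*) [Field K] (A : Type) [Group A] [Fintype A]
    (h : IsRationalExtension K (NoetherField K A)) :
    ∃ m : ℕ, m ≤ Fintype.card A ∧ ∃ p : Fin m → NoetherBigField K A,
      (∀ i, p i ∈ noetherSubfield K A) ∧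
      ∀ M : Subfield (NoetherBigField K A), (∀ c : K, algebraMap K _ c ∈ M) → (∀ i, p i ∈ M) →
        noetherSubfield K A ≤ M := by
  obtain ⟨m, ⟨e⟩⟩ := h
  let s : NoetherField K A →ₐ[K] NoetherBigField K A :=
    { (noetherSubfield K A).subtype with commutes' := fun c => rfl }
  let φ : NoetherBigField K (Fin m) →ₐ[K] NoetherBigField K A := s.comp e.symm.toAlgHom
  refine ⟨m, ?_, fun i => φ (var K i), ?_, ?_⟩
  · have := trdeg_le_of_injective φ φ.injective
    rw [trdeg_big, trdeg_big] at this
    simpa using this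
  · intro i
    exact (show noetherSubfield K A from e.symm (var K i)).2
  · intro M hK hp x hx
    have := top_of_var (M.comap φ.toRingHom)
      (fun c => by
        change φ (algebraMap _ _ c) ∈ M
        rw [φ.commutes]; exact hK c) hp
    have h2 : e (show NoetherField K A from ⟨x, hx⟩) ∈ M.comap φ.toRingHom := by
      rw [this]; trivial
    have h3 : φ (e (show NoetherField K A from ⟨x, hx⟩)) = x := by
      change s (e.symm (e _)) = x
      rw [e.symm_apply_apply]
      rfl
    rw [← h3]
    exact h2

/-- reduction modulo n -/
def piHom (n : ℕ) : DihedralGroup (2 * n) → DihedralGroup n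
  | r i => r (ZMod.castHom (Dvd.intro_left 2 rfl) (ZMod n) i)
  | sr i => sr (ZMod.castHom (Dvd.intro_left 2 rfl) (ZMod n) i)

theorem piHom_mul (n : ℕ) (a b : DihedralGroup (2 * n)) :
    piHom n (a * b) = piHom n a * piHom n b := by
  cases a <;> cases b <;> simp only [r_mul_r, r_mul_sr, sr_mul_r, sr_mul_sr, piHom, map_add, map_sub]

theorem piHom_one (n : ℕ) : piHom n 1 = 1 := by
  rw [one_def, one_def]; simp only [piHom, map_zero]

def ep1 (n : ℕ) : DihedralGroup (2 * n) → ZMod 2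
  | r _ => 0
  | sr _ => 1

def ep2 (n : ℕ) : DihedralGroup (2 * n) → ZMod 2
  | r i => ZMod.castHom (Dvd.intro n rfl) (ZMod 2) i
  | sr i => ZMod.castHom (Dvd.intro n rfl) (ZMod 2) i

theorem ep1_mul (n : ℕ) (a b : DihedralGroup (2 * n)) :
    ep1 n (a * b) = ep1 n a + ep1 n b := by
  cases a <;> cases b <;> simp only [r_mul_r, r_mul_sr, sr_mul_r, sr_mul_sr, ep1] <;> decide

theorem ep2_mul (n : ℕ) (a b : DihedralGroup (2 * n)) :
    ep2 n (a * b) = ep2 n a + ep2 n b := by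
  have h : ∀ x y : ZMod 2, y - x = x + y := by decide
  cases a <;> cases b <;>
    simp only [r_mul_r, r_mul_sr, sr_mul_r, sr_mul_sr, ep2, map_add, map_sub, h]

abbrev Gam (n : ℕ) : Type := Multiplicative (ZMod n) × DihedralGroup (2 * n)

inductive ZA (n : ℕ) : Type
  | w (c : Multiplicative (ZMod n)) : ZA n
  | z (g : DihedralGroup (2 * n)) : ZA n

inductive ZB (n : ℕ) : Type
  | d (c : DihedralGroup n) : ZB n
  | t (a : ZMod 2) : ZB n
  | s (a : ZMod 2) : ZB n

def eqvA (n : ℕ) : ZA n ≃ (Multiplicative (ZMod n) ⊕ DihedralGroup (2 * n)) where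
  toFun x := match x with
    | .w c => .inl c
    | .z g => .inr g
  invFun x := match x with
    | .inl c => .w c
    | .inr g => .z g
  left_inv x := by cases x <;> rfl
  right_inv x := by rcases x with _ | _ <;> rfl

def eqvB (n : ℕ) : ZB n ≃ (DihedralGroup n ⊕ (ZMod 2 ⊕ ZMod 2)) where
  toFun x := match x with
    | .d c => .inl c
    | .t g => .inr (.inl g)
    | .s g => .inr (.inr g)
  invFun x := match x with
    | .inl c => .d c
    | .inr (.inl g) => .t g
    | .inr (.inr g) => .s g
  left_inv x := by cases x <;> rfl
  right_inv x := by rcases x with _ | _ | _ <;> rfl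

instance (n : ℕ) [NeZero n] : Fintype (ZA n) := Fintype.ofEquiv _ (eqvA n).symm
instance (n : ℕ) [NeZero n] : Fintype (ZB n) := Fintype.ofEquiv _ (eqvB n).symm

theorem cardA (n : ℕ) [NeZero n] : Fintype.card (ZA n) = n + 4 * n := by
  rw [Fintype.card_congr (eqvA n), Fintype.card_sum, DihedralGroup.card, Fintype.card_multiplicative,
    ZMod.card]
  ring

theorem cardB (n : ℕ) [NeZero n] : Fintype.card (ZB n) = 2 * n + 4 := by
  rw [Fintype.card_congr (eqvB n), Fintype.card_sum, Fintype.card_sum, DihedralGroup.card,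
    ZMod.card]

theorem cardG (n : ℕ) [NeZero n] : Fintype.card (Gam n) = n * (4 * n) := by
  rw [Fintype.card_prod, DihedralGroup.card, Fintype.card_multiplicative, ZMod.card]
  ring

instance (n : ℕ) : MulAction (Gam n) (ZA n) where
  smul γ x := match x with
    | .w c => .w (γ.1 * c)
    | .z g => .z (γ.2 * g)
  one_smul x := by
    cases x
    · exact congrArg ZA.w (one_mul _)
    · exact congrArg ZA.z (one_mul _)
  mul_smul a b x := by
    cases x
    · exact congrArg ZA.w (mul_assoc _ _ _)
    · exact congrArg ZA.z (mul_assoc _ _ _)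

instance (n : ℕ) : MulAction (Gam n) (ZB n) where
  smul γ x := match x with
    | .d c => .d (piHom n γ.2 * c * r (-(Multiplicative.toAdd γ.1)))
    | .t a => .t (ep1 n γ.2 + a)
    | .s a => .s (ep2 n γ.2 + a)
  one_smul x := by
    cases x with
    | d c =>
      refine congrArg ZB.d ?_
      change piHom n 1 * c * r (-0) = c
      rw [piHom_one, neg_zero, ← one_def, mul_one, one_mul]
    | t a => exact congrArg ZB.t (zero_add _)
    | s a =>
      refine congrArg ZB.s ?_
      change ZMod.castHom (Dvd.intro n rfl) (ZMod 2) 0 + a = a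
      rw [map_zero, zero_add]
  mul_smul a b x := by
    cases x with
    | d c =>
      refine congrArg ZB.d ?_
      change piHom n (a.2 * b.2) * c * r (-(Multiplicative.toAdd a.1 + Multiplicative.toAdd b.1)) =
        piHom n a.2 * (piHom n b.2 * c * r (-(Multiplicative.toAdd b.1))) *
          r (-(Multiplicative.toAdd a.1))
      rw [piHom_mul, neg_add_rev, ← r_mul_r]
      simp only [mul_assoc]
    | t x =>
      refine congrArg ZB.t ?_
      change ep1 n (a.2 * b.2) + x = _
      rw [ep1_mul, add_assoc]
    | s x =>
      refine congrArg ZB.s ?_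
      change ep2 n (a.2 * b.2) + x = _
      rw [ep2_mul, add_assoc]

theorem smul_w {n : ℕ} (γ : Gam n) (c) : γ • ZA.w c = ZA.w (γ.1 * c) := rfl
theorem smul_z {n : ℕ} (γ : Gam n) (c) : γ • (ZA.z c : ZA n) = ZA.z (γ.2 * c) := rfl
theorem smul_d {n : ℕ} (γ : Gam n) (c) :
    γ • ZB.d c = ZB.d (piHom n γ.2 * c * r (-(Multiplicative.toAdd γ.1))) := rfl
theorem smul_t {n : ℕ} (γ : Gam n) (c) : γ • (ZB.t c : ZB n) = ZB.t (ep1 n γ.2 + c) := rfl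
theorem smul_s {n : ℕ} (γ : Gam n) (c) : γ • (ZB.s c : ZB n) = ZB.s (ep2 n γ.2 + c) := rfl

instance (n : ℕ) : FaithfulSMul (Gam n) (ZA n) where
  eq_of_smul_eq_smul {a b} h := by
    have h1 := h (.w 1)
    have h2 := h (.z 1)
    rw [smul_w, smul_w, mul_one, mul_one] at h1
    rw [smul_z, smul_z, mul_one, mul_one] at h2
    exact Prod.ext (ZA.w.inj h1) (ZA.z.inj h2)

theorem faithB (n : ℕ) (hn : Odd n) : FaithfulSMul (Gam n) (ZB n) where
  eq_of_smul_eq_smul {a b} h := by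
    have key : ∀ g : Gam n, (∀ x : ZB n, g • x = x) → g = 1 := by
      rintro ⟨c, g⟩ h
      have h1 := ZB.d.inj (h (.d 1))
      have h2 := ZB.d.inj (h (.d (sr 0)))
      have h3 := ZB.s.inj (h (.s 0))
      cases g with
      | sr i =>
        rw [one_def] at h1
        simp only [piHom, sr_mul_r] at h1
        cases h1
      | r i =>
        rw [one_def] at h1
        simp only [piHom, r_mul_r, r_mul_sr, sr_mul_r, ep2, add_zero] at h1 h2 h3
        have h1 := r.inj h1
        have h2 := sr.inj h2
        set j := ZMod.castHom (Dvd.intro_left 2 rfl) (ZMod n) i with hj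
        have h4 : c.toAdd = j := by
          rw [eq_comm, ← sub_eq_zero, sub_eq_add_neg]; exact h1
        rw [h4] at h2
        have h5 : 2 * j = 0 := by
          have : 2 * j = -(0 - j + -j) := by ring
          rw [this, h2, neg_zero]
        have h6 : IsUnit (2 : ZMod n) := by
          have := (ZMod.isUnit_iff_coprime 2 n).2 (Nat.coprime_two_left.2 hn)
          exact_mod_cast this
        have h7 : j = 0 := (h6.mul_right_eq_zero).1 h5
        have h8 : i = 0 := by
          obtain ⟨k, rfl⟩ := ZMod.intCast_surjective i
          rw [h7] at hj
          rw [map_intCast] at hj h3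
          rw [eq_comm, ZMod.intCast_zmod_eq_zero_iff_dvd] at hj
          rw [ZMod.intCast_zmod_eq_zero_iff_dvd] at h3
          rw [ZMod.intCast_zmod_eq_zero_iff_dvd]
          push_cast at *
          refine IsCoprime.mul_dvd ?_ h3 hj
          exact_mod_cast (Nat.coprime_two_left.2 hn).isCoprime
        rw [h8, ← one_def]
        rw [h7] at h4
        exact Prod.ext h4 rfl
    have := key (b⁻¹ * a) (fun x => by rw [mul_smul, h x, inv_smul_smul])
    exact (inv_mul_eq_one.1 this).symm

end NDS


namespace NDS
open IntermediateField DihedralGroup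

theorem rank_emb (K : Type*) [Field K] {A B : Type} [Group A] [Fintype A] (j : A → B)
    (hj : Function.Injective j) (F : Subfield (NoetherBigField K B))
    (h : ∀ p ∈ noetherSubfield K A, emb K j hj p ∈ F) (e : ℕ)
    (he : ∀ M : Subfield (NoetherBigField K B), F ≤ M → (∀ a, var K (j a) ∈ M) →
      Module.rank M (NoetherBigField K B) ≤ e) :
    Module.rank F (NoetherBigField K B) ≤ (Fintype.card A * e : ℕ) := by
  refine rank_step ((noetherSubfield K A).map (emb K j hj).toRingHom)
    ((emb K j hj).toRingHom.fieldRange) F ?_ ?_ _ _ (relrank_emb K j hj) ?_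
  · rintro _ ⟨x, _, rfl⟩
    exact ⟨x, rfl⟩
  · rintro _ ⟨x, hx, rfl⟩
    exact h x hx
  · refine he _ le_sup_left ?_
    intro a
    have h1 : (emb K j hj).toRingHom.fieldRange ≤ F ⊔ (emb K j hj).toRingHom.fieldRange :=
      le_sup_right
    exact h1 ⟨var K a, emb_var K j hj a⟩

theorem gens_emb (K : Type*) [Field K] {A B : Type} [Group A] (j : A → B)
    (hj : Function.Injective j) {m : ℕ} (p : Fin m → NoetherBigField K A)
    (hp : ∀ M : Subfield (NoetherBigField K A), (∀ c : K, algebraMap K _ c ∈ M) → (∀ i, p i ∈ M) →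
        noetherSubfield K A ≤ M)
    (F : Subfield (NoetherBigField K B)) (hK : ∀ c : K, algebraMap K _ c ∈ F)
    (hF : ∀ i, emb K j hj (p i) ∈ F) (x : NoetherBigField K A) (hx : x ∈ noetherSubfield K A) :
    emb K j hj x ∈ F := by
  refine hp (F.comap (emb K j hj).toRingHom) (fun c => ?_) hF hx
  change emb K j hj (algebraMap _ _ c) ∈ F
  rw [(emb K j hj).commutes]
  exact hK c

theorem rank_one_of {K : Type*} [Field K] {Z : Type*} (F : Subfield (NoetherBigField K Z))
    (hK : ∀ c : K, algebraMap K _ c ∈ F) (hv : ∀ z, var K z ∈ F) :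
    Module.rank F (NoetherBigField K Z) ≤ (1 : ℕ) := by
  rw [top_of_var F hK hv, ← Subfield.relrank_top_right, Subfield.relrank_self, Nat.cast_one]

abbrev ZZ (n : ℕ) : Type := ZA n ⊕ ZB n

def jw (n : ℕ) (c : Multiplicative (ZMod n)) : ZZ n := .inl (.w c)
def jz (n : ℕ) (g : DihedralGroup (2 * n)) : ZZ n := .inl (.z g)
def jr (n : ℕ) (c : Multiplicative (ZMod n)) : ZZ n := .inr (.d (r (Multiplicative.toAdd c)))
def js (n : ℕ) (c : Multiplicative (ZMod n)) : ZZ n := .inr (.d (sr (Multiplicative.toAdd c)))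

theorem jw_inj (n : ℕ) : Function.Injective (jw n) :=
  fun _ _ h => ZA.w.inj (Sum.inl.inj h)
theorem jz_inj (n : ℕ) : Function.Injective (jz n) :=
  fun _ _ h => ZA.z.inj (Sum.inl.inj h)
theorem jr_inj (n : ℕ) : Function.Injective (jr n) :=
  fun _ _ h => r.inj (ZB.d.inj (Sum.inr.inj h))
theorem js_inj (n : ℕ) : Function.Injective (js n) :=
  fun _ _ h => sr.inj (ZB.d.inj (Sum.inr.inj h))

theorem smul_jr (n : ℕ) (γ : Gam n) :
    ∃ h : Multiplicative (ZMod n), ∀ a, γ • jr n a = (if ep1 n γ.2 = 0 then jr n else js n) (h * a) := by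
  obtain ⟨c, g⟩ := γ
  cases g with
  | r i =>
    refine ⟨Multiplicative.ofAdd
      (ZMod.castHom (Dvd.intro_left 2 rfl) (ZMod n) i - c.toAdd), fun a => ?_⟩
    rw [if_pos (by rfl)]
    refine congrArg (fun x => (Sum.inr (ZB.d x) : ZZ n)) ?_
    simp only [piHom, r_mul_r, toAdd_mul, toAdd_ofAdd]
    congr 1
    ring
  | sr i =>
    refine ⟨Multiplicative.ofAdd
      (ZMod.castHom (Dvd.intro_left 2 rfl) (ZMod n) i - c.toAdd), fun a => ?_⟩
    rw [if_neg (by simp [ep1])]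
    refine congrArg (fun x => (Sum.inr (ZB.d x) : ZZ n)) ?_
    simp only [piHom, sr_mul_r, toAdd_mul, toAdd_ofAdd]
    congr 1
    ring

theorem smul_js (n : ℕ) (γ : Gam n) :
    ∃ h : Multiplicative (ZMod n), ∀ a, γ • js n a = (if ep1 n γ.2 = 0 then js n else jr n) (h * a) := by
  obtain ⟨c, g⟩ := γ
  cases g with
  | r i =>
    refine ⟨Multiplicative.ofAdd
      (-ZMod.castHom (Dvd.intro_left 2 rfl) (ZMod n) i - c.toAdd), fun a => ?_⟩
    rw [if_pos (by rfl)]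
    refine congrArg (fun x => (Sum.inr (ZB.d x) : ZZ n)) ?_
    simp only [piHom, r_mul_sr, sr_mul_r, toAdd_mul, toAdd_ofAdd]
    congr 1
    ring
  | sr i =>
    refine ⟨Multiplicative.ofAdd
      (-ZMod.castHom (Dvd.intro_left 2 rfl) (ZMod n) i - c.toAdd), fun a => ?_⟩
    rw [if_neg (by simp [ep1])]
    refine congrArg (fun x => (Sum.inr (ZB.d x) : ZZ n)) ?_
    simp only [piHom, sr_mul_sr, r_mul_r, toAdd_mul, toAdd_ofAdd]
    congr 1
    ring

theorem main (K : Type*) [Field K] (n : ℕ) [NeZero n] (hn : Odd n)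
    (hcyc : IsRationalExtension K (NoetherField K (Multiplicative (ZMod n)))) :
    IsStablyRationalExtension K (NoetherField K (DihedralGroup (2 * n))) := by
  obtain ⟨m, hm, p, hp, hgen⟩ := cyc_gens K _ hcyc
  rw [Fintype.card_multiplicative, ZMod.card] at hm
  have := faithB n hn
  let inst := actInst K (Gam n) (ZZ n)
  have sv : ∀ (γ : Gam n) (z : ZZ n), γ • (var K z) = var K (γ • z) :=
    fun γ z => actHom_var K (Gam n) (ZZ n) γ z
  have hcomm : SMulCommClass (Gam n) K (NoetherBigField K (ZZ n)) :=
    ⟨fun γ k x => map_smul (actHom K (Gam n) (ZZ n) γ) k x⟩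
  have hfaith : FaithfulSMul (Gam n) (NoetherBigField K (ZZ n)) := by
    constructor
    intro a b h
    apply FaithfulSMul.eq_of_smul_eq_smul (M := Gam n) (α := ZA n)
    intro z
    have := h (var K (Sum.inl z))
    rw [sv, sv] at this
    exact Sum.inl.inj (var_injective K this)
  obtain ⟨yB, hyB, hyB'⟩ := nn (K := K) (Γ := Gam n) (X := ZA n) (Y := ZB n)
    (fun z => var K (Sum.inl z : ZZ n)) (fun a b h => Sum.inl.inj (var_injective K h))
    (fun z => var K (Sum.inr z : ZZ n)) (fun γ z => sv γ _) (fun γ z => sv γ _)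
  obtain ⟨yA, hyA, hyA'⟩ := nn (K := K) (Γ := Gam n) (X := ZB n) (Y := ZA n)
    (fun z => var K (Sum.inr z : ZZ n)) (fun a b h => Sum.inr.inj (var_injective K h))
    (fun z => var K (Sum.inl z : ZZ n)) (fun γ z => sv γ _) (fun γ z => sv γ _)
  let φ : NoetherField K (DihedralGroup (2 * n)) →+* NoetherBigField K (ZZ n) :=
    (emb K (jz n) (jz_inj n)).toRingHom.comp (noetherSubfield K (DihedralGroup (2 * n))).subtype
  let algF : Algebra (NoetherField K (DihedralGroup (2 * n))) (NoetherBigField K (ZZ n)) :=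
    φ.toAlgebra
  have tower : IsScalarTower K (NoetherField K (DihedralGroup (2 * n)))
      (NoetherBigField K (ZZ n)) := by
    apply IsScalarTower.of_algebraMap_eq
    intro c
    exact ((emb K (jz n) (jz_inj n)).commutes c).symm
  have hcardE : Algebra.trdeg K (NoetherBigField K (ZZ n)) = (n + 4 * n + (2 * n + 4) : ℕ) := by
    rw [trdeg_big, Fintype.card_sum, cardA, cardB]
  let t : ZMod 2 → NoetherBigField K (ZZ n) := fun a => var K (Sum.inr (ZB.t a))
  let s : ZMod 2 → NoetherBigField K (ZZ n) := fun a => var K (Sum.inr (ZB.s a))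
  let u : Fin m → NoetherBigField K (ZZ n) := fun i => emb K (jr n) (jr_inj n) (p i)
  let v : Fin m → NoetherBigField K (ZZ n) := fun i => emb K (js n) (js_inj n) (p i)
  let f : Fin m ⊕ ZB n → NoetherBigField K (ZZ n) :=
    Sum.elim (fun i => emb K (jw n) (jw_inj n) (p i)) yB
  let g : (Fin 4 ⊕ (Fin m ⊕ Fin m)) ⊕ ZA n → NoetherBigField K (ZZ n) :=
    Sum.elim (Sum.elim ![t 0 + t 1, t 0 * t 1, s 0 + s 1, s 0 * s 1]
      (Sum.elim (fun i => u i + v i) (fun i => t 0 * u i + t 1 * v i))) yA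
  have cases2 : ∀ x : ZMod 2, x = 0 ∨ x = 1 := by decide
  have ht : ∀ γ : Gam n, (ep1 n γ.2 = 0 ∧ γ • t 0 = t 0 ∧ γ • t 1 = t 1) ∨
      (ep1 n γ.2 = 1 ∧ γ • t 0 = t 1 ∧ γ • t 1 = t 0) := by
    intro γ
    have e : ∀ a, γ • t a = t (ep1 n γ.2 + a) := fun a => sv γ _
    rw [e, e]
    rcases cases2 (ep1 n γ.2) with h | h
    · left; rw [h]; exact ⟨rfl, rfl, rfl⟩
    · right; rw [h]; exact ⟨rfl, rfl, rfl⟩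
  have hs : ∀ γ : Gam n, (γ • s 0 = s 0 ∧ γ • s 1 = s 1) ∨ (γ • s 0 = s 1 ∧ γ • s 1 = s 0) := by
    intro γ
    have e : ∀ a, γ • s a = s (ep2 n γ.2 + a) := fun a => sv γ _
    rw [e, e]
    rcases cases2 (ep2 n γ.2) with h | h
    · left; rw [h]; exact ⟨rfl, rfl⟩
    · right; rw [h]; exact ⟨rfl, rfl⟩
  have hu0 : ∀ γ : Gam n, ep1 n γ.2 = 0 → ∀ i, γ • u i = u i := by
    intro γ h i
    obtain ⟨a, ha⟩ := smul_jr n γ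
    rw [if_pos h] at ha
    exact actHom_emb K _ _ (jr_inj n) (jr_inj n) γ a ha (p i) (hp i)
  have hv0 : ∀ γ : Gam n, ep1 n γ.2 = 0 → ∀ i, γ • v i = v i := by
    intro γ h i
    obtain ⟨a, ha⟩ := smul_js n γ
    rw [if_pos h] at ha
    exact actHom_emb K _ _ (js_inj n) (js_inj n) γ a ha (p i) (hp i)
  have hu1 : ∀ γ : Gam n, ep1 n γ.2 = 1 → ∀ i, γ • u i = v i := by
    intro γ h i
    obtain ⟨a, ha⟩ := smul_jr n γ
    rw [if_neg (by rw [h]; decide)] at ha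
    exact actHom_emb K _ _ (jr_inj n) (js_inj n) γ a ha (p i) (hp i)
  have hv1 : ∀ γ : Gam n, ep1 n γ.2 = 1 → ∀ i, γ • v i = u i := by
    intro γ h i
    obtain ⟨a, ha⟩ := smul_js n γ
    rw [if_neg (by rw [h]; decide)] at ha
    exact actHom_emb K _ _ (js_inj n) (jr_inj n) γ a ha (p i) (hp i)
  have ht01 : t 0 ≠ t 1 := by
    intro h
    have := ZB.t.inj (Sum.inr.inj (var_injective K h))
    exact absurd this (by decide)
  refine core (Γ := Gam n) f g ?_ ?_ ?_ ?_ ?_ ?_ ?_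
  · intro γ c
    exact actHom_emb K _ _ (jz_inj n) (jz_inj n) γ γ.2 (fun a => rfl)
      ((noetherSubfield K (DihedralGroup (2 * n))).subtype c)
      (show noetherSubfield K (DihedralGroup (2 * n)) from c).2
  · rintro γ (i | j)
    · exact actHom_emb K _ _ (jw_inj n) (jw_inj n) γ γ.1 (fun a => rfl) (p i) (hp i)
    · exact hyB γ j
  · rintro γ ((i | (i | i)) | j)
    · fin_cases i
      · change γ • (t 0 + t 1) = t 0 + t 1
        rw [smul_add]
        rcases ht γ with ⟨_, h, h'⟩ | ⟨_, h, h'⟩ <;> rw [h, h']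
        rw [add_comm]
      · change γ • (t 0 * t 1) = t 0 * t 1
        rw [smul_mul']
        rcases ht γ with ⟨_, h, h'⟩ | ⟨_, h, h'⟩ <;> rw [h, h']
        rw [mul_comm]
      · change γ • (s 0 + s 1) = s 0 + s 1
        rw [smul_add]
        rcases hs γ with ⟨h, h'⟩ | ⟨h, h'⟩ <;> rw [h, h']
        rw [add_comm]
      · change γ • (s 0 * s 1) = s 0 * s 1
        rw [smul_mul']
        rcases hs γ with ⟨h, h'⟩ | ⟨h, h'⟩ <;> rw [h, h']
        rw [mul_comm]
    · change γ • (u i + v i) = u i + v i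
      rw [smul_add]
      rcases ht γ with ⟨e, _, _⟩ | ⟨e, _, _⟩
      · rw [hu0 γ e, hv0 γ e]
      · rw [hu1 γ e, hv1 γ e, add_comm]
    · change γ • (t 0 * u i + t 1 * v i) = t 0 * u i + t 1 * v i
      rw [smul_add, smul_mul', smul_mul']
      rcases ht γ with ⟨e, h, h'⟩ | ⟨e, h, h'⟩
      · rw [hu0 γ e, hv0 γ e, h, h']
      · rw [hu1 γ e, hv1 γ e, h, h', add_comm]
    · exact hyA γ j
  · intro M hFM hfM
    have hK : ∀ c : K, algebraMap K _ c ∈ M := by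
      intro c
      rw [IsScalarTower.algebraMap_apply K (NoetherField K (DihedralGroup (2 * n)))]
      exact hFM _
    have h1 := rank_emb K (jw n) (jw_inj n) M
      (gens_emb K (jw n) (jw_inj n) p hgen M hK (fun i => hfM (.inl i))) (4 * n) ?_
    · rw [Fintype.card_multiplicative, ZMod.card] at h1
      rw [cardG]
      exact h1
    intro M1 hM1 hw
    have h2 := rank_emb K (jz n) (jz_inj n) M1
      (fun q hq => hM1 (hFM (show NoetherField K (DihedralGroup (2 * n)) from ⟨q, hq⟩))) 1 ?_
    · rw [DihedralGroup.card] at h2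
      have e : 2 * (2 * n) * 1 = 4 * n := by ring
      rw [e] at h2
      exact h2
    intro M2 hM2 hz
    have hK2 : ∀ c : K, algebraMap K _ c ∈ M2 := fun c => hM2 (hM1 (hK c))
    have hA : ∀ z : ZA n, var K (Sum.inl z : ZZ n) ∈ M2 := by
      intro z
      cases z with
      | w c => exact hM2 (hw c)
      | z c => exact hz c
    refine rank_one_of M2 hK2 ?_
    rintro (z | z)
    · exact hA z
    · exact hyB' M2 hK2 hA (fun j => hM2 (hM1 (hfM (.inr j)))) z
  · intro M hK hgM
    have h1 := side2 M (t 0) (t 1) (s 0) (s 1) u v ht01 (hgM (.inl (.inl 0)))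
      (hgM (.inl (.inl 1))) (hgM (.inl (.inl 2))) (hgM (.inl (.inl 3)))
      (fun i => hgM (.inl (.inr (.inl i)))) (fun i => hgM (.inl (.inr (.inr i)))) (n * n) ?_
    · rw [cardG]
      have e : 2 * (2 * (n * n)) = n * (4 * n) := by ring
      rw [e] at h1
      exact h1
    intro M0 hM0 ht0 ht1 hs0 hs1 hu hv
    have hK0 : ∀ c : K, algebraMap K _ c ∈ M0 := fun c => hM0 (hK c)
    have h2 := rank_emb K (jr n) (jr_inj n) M0
      (gens_emb K (jr n) (jr_inj n) p hgen M0 hK0 hu) n ?_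
    · rw [Fintype.card_multiplicative, ZMod.card] at h2
      exact h2
    intro M1 hM1 hr
    have hK1 : ∀ c : K, algebraMap K _ c ∈ M1 := fun c => hM1 (hK0 c)
    have h3 := rank_emb K (js n) (js_inj n) M1
      (gens_emb K (js n) (js_inj n) p hgen M1 hK1 (fun i => hM1 (hv i))) 1 ?_
    · rw [Fintype.card_multiplicative, ZMod.card, mul_one] at h3
      exact h3
    intro M2 hM2 hsr
    have hK2 : ∀ c : K, algebraMap K _ c ∈ M2 := fun c => hM2 (hK1 c)
    have hB : ∀ z : ZB n, var K (Sum.inr z : ZZ n) ∈ M2 := by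
      intro z
      cases z with
      | d c =>
        cases c with
        | r i => exact hM2 (hr (Multiplicative.ofAdd i))
        | sr i => exact hsr (Multiplicative.ofAdd i)
      | t a =>
        rcases cases2 a with rfl | rfl
        · exact hM2 (hM1 ht0)
        · exact hM2 (hM1 ht1)
      | s a =>
        rcases cases2 a with rfl | rfl
        · exact hM2 (hM1 hs0)
        · exact hM2 (hM1 hs1)
    refine rank_one_of M2 hK2 ?_
    rintro (z | z)
    · exact hyA' M2 hK2 hB (fun j => hM2 (hM1 (hM0 (hgM (.inr j))))) z
    · exact hB z
  · have h1 := trdeg_add_eq K (NoetherField K (DihedralGroup (2 * n)))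
      (A := NoetherBigField K (ZZ n))
    let sub : NoetherField K (DihedralGroup (2 * n)) →ₐ[K]
        NoetherBigField K (DihedralGroup (2 * n)) :=
      { (noetherSubfield K (DihedralGroup (2 * n))).subtype with commutes' := fun c => rfl }
    have h2 := trdeg_le_of_injective sub sub.injective
    rw [trdeg_big, DihedralGroup.card] at h2
    rw [hcardE] at h1
    rw [Nat.card_sum, Nat.card_fin, Nat.card_eq_fintype_card, cardB]
    obtain ⟨a, ha⟩ := Cardinal.lt_aleph0.1 (lt_of_le_of_lt h2 Cardinal.natCast_lt_aleph0)
    obtain ⟨b, hb⟩ := Cardinal.lt_aleph0.1 (lt_of_le_of_lt (h1 ▸ le_add_self :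
      Algebra.trdeg (NoetherField K (DihedralGroup (2 * n))) (NoetherBigField K (ZZ n)) ≤
        (n + 4 * n + (2 * n + 4) : ℕ)) Cardinal.natCast_lt_aleph0)
    rw [ha] at h1 h2
    rw [hb] at h1 ⊢
    norm_cast at h1 h2 ⊢
    omega
  · rw [hcardE, Nat.card_sum, Nat.card_sum, Nat.card_sum, Nat.card_fin, Nat.card_fin,
      Nat.card_eq_fintype_card, cardA]
    norm_cast
    omega

end NDS

/-- Theorem 4.2 (second part): for any field `K` and odd `n`, if `K(ℤ/nℤ)` is rational over
`K`, then `K(D₂ₙ)` is stably rational over `K`. -/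
theorem noether_dihedral_double_stably_rational
    (K : Type*) [Field K] (n : ℕ) (hn : Odd n) (hpos : 0 < n)
    (hcyc : IsRationalExtension K (NoetherField K (Multiplicative (ZMod n)))) :
    IsStablyRationalExtension K (NoetherField K (DihedralGroup (2 * n))) := by
  have : NeZero n := ⟨hpos.ne'⟩
  exact NDS.main K n hn hcyc

end
end
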